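/- arXiv:2207.13902 — 5 statements merged into one kernel-verified Lean document; each statement's English description precedes it below -/
import Mathlib

section
/- Let p be a prime number, let Λ = ℤ_p⟦T⟧ be the ring of formal power series over the p-adic integers, and for n ≥ 0 set ω_n = (1+T)^{p^n} − 1 ∈ Λ; for m ≥ n let ν_{m,n} = ω_m/ω_n ∈ Λ (a polynomial, since ω_n divides ω_m). Let M be a Λ-module such that: (i) ⋂_{n≥0} ω_n M = 0, and (ii) for all m ≥ n ≥ 0 and all x ∈ M, if ν_{m,n}·x ∈ ω_m M then x ∈ ω_n M. Then M contains no nonzero finite Λ-submodule. -/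
open PowerSeries

/-- Let `Λ = ℤ_p⟦T⟧` and `ω n = (1+T)^(p^n) - 1`.  Let `M` be a `Λ`-module such that
(i) `⋂ₙ ωₙ M = 0`, and (ii) for all `m ≥ n` and `ν` with `ν * ωₙ = ωₘ` (i.e.
`ν = ωₘ/ωₙ`), if `ν • x ∈ ωₘ M` then `x ∈ ωₙ M`.  Then `M` has no nonzero finite
`Λ`-submodule. -/
theorem no_finite_submodule_of_omega_conditions
    (p : ℕ) [Fact p.Prime]
    (M : Type*) [AddCommGroup M] [Module (PowerSeries ℤ_[p]) M]
    (ω : ℕ → PowerSeries ℤ_[p])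
    (hω : ∀ n, ω n = (1 + PowerSeries.X) ^ p ^ n - 1)
    (hinter : ∀ x : M, (∀ n : ℕ, ∃ z : M, x = ω n • z) → x = 0)
    (hinj : ∀ m n : ℕ, n ≤ m → ∀ ν : PowerSeries ℤ_[p], ν * ω n = ω m →
      ∀ x : M, (∃ z : M, ν • x = ω m • z) → ∃ z : M, x = ω n • z) :
    ∀ N : Submodule (PowerSeries ℤ_[p]) M, (N : Set M).Finite → N = ⊥ := by
  classical
  intro N hN
  have hfin : Finite N := hN
  set J := IsLocalRing.maximalIdeal (PowerSeries ℤ_[p]) with hJ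
  -- some power of the maximal ideal kills `N`
  obtain ⟨k, hk⟩ : ∃ k : ℕ, J ^ k • (⊤ : Submodule (PowerSeries ℤ_[p]) N) = ⊥ := by
    obtain ⟨k, hk⟩ := IsArtinian.monotone_stabilizes
      (⟨fun k => OrderDual.toDual (J ^ k • (⊤ : Submodule (PowerSeries ℤ_[p]) N)),
        fun a b hab => Submodule.smul_mono_left (Ideal.pow_le_pow_right hab)⟩ :
        ℕ →o (Submodule (PowerSeries ℤ_[p]) N)ᵒᵈ)
    refine ⟨k, ?_⟩
    have h1 : J ^ k • (⊤ : Submodule (PowerSeries ℤ_[p]) N) = J ^ (k + 1) • ⊤ :=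
      hk (k + 1) (Nat.le_succ k)
    refine Submodule.eq_bot_of_le_smul_of_le_jacobson_bot J _ ?_ ?_ ?_
    · exact IsNoetherian.noetherian _
    · rw [← Submodule.mul_smul, ← pow_succ']
      exact h1.le
    · exact IsLocalRing.maximalIdeal_le_jacobson _
  have hν : ∀ n j : ℕ, ∃ ν ∈ J ^ j, ν * ω n = ω (n + j) := by
    intro n j
    induction j with
    | zero => exact ⟨1, by simp, by simp⟩
    | succ j ih =>
      obtain ⟨ν, hνJ, hνe⟩ := ih
      refine ⟨(∑ i ∈ Finset.range p, ((1 + PowerSeries.X) ^ p ^ (n + j)) ^ i) * ν, ?_, ?_⟩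
      · rw [pow_succ']
        refine Ideal.mul_mem_mul ?_ hνJ
        rw [hJ, IsLocalRing.mem_maximalIdeal, mem_nonunits_iff, PowerSeries.isUnit_iff_constantCoeff]
        simpa using PadicInt.p_nonunit
      · rw [mul_assoc, hνe, hω (n + j), geom_sum_mul, hω, ← pow_mul, ← pow_succ, add_assoc]
  rw [Submodule.eq_bot_iff]
  intro x hx
  refine hinter x fun n => ?_
  obtain ⟨ν, hνJ, hνe⟩ := hν n k
  refine hinj (n + k) n (Nat.le_add_right n k) ν hνe x ⟨0, ?_⟩
  have h2 : ν • (⟨x, hx⟩ : N) ∈ J ^ k • (⊤ : Submodule (PowerSeries ℤ_[p]) N) :=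
    Submodule.smul_mem_smul hνJ trivial
  rw [hk, Submodule.mem_bot] at h2
  simpa using congrArg Subtype.val h2
end

section
/- Let p be a prime number, let Λ = ℤ_p⟦T⟧, and for n ≥ 0 set ω_n = (1+T)^{p^n} − 1 ∈ Λ. Let M be a Λ-module whose underlying ℤ_p-module is finitely generated, of ℤ_p-rank λ, and suppose that the quotient M/ω_n M is finite for every n ≥ 0. Then there exist an integer ν and an index N such that for all n ≥ N the cardinality of M/ω_n M equals p^{λn + ν}. -/
open PowerSeries

theorem aux_index_free (p : ℕ) [Fact p.Prime] (L : Type*) [AddCommGroup L] [Module ℤ_[p] L]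
    [Module.Free ℤ_[p] L] [Module.Finite ℤ_[p] L] (H : AddSubgroup L)
    (hH : ∀ x, x ∈ H ↔ ∃ y : L, (p : ℤ_[p]) • y = x) :
    H.index = p ^ Module.finrank ℤ_[p] L := by
  let b := Module.finBasis ℤ_[p] L
  let f : L →+ (Fin (Module.finrank ℤ_[p] L) → ZMod p) :=
    { toFun := fun x i => PadicInt.toZMod (b.equivFun x i)
      map_zero' := by ext; simp
      map_add' := by intros; ext; simp }
  have hsurj : Function.Surjective f := by
    intro v
    choose w hw using fun i => ZMod.ringHom_surjective (PadicInt.toZMod (p := p)) (v i)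
    refine ⟨b.equivFun.symm w, ?_⟩
    funext i
    change PadicInt.toZMod (b.equivFun (b.equivFun.symm w) i) = v i
    rw [LinearEquiv.apply_symm_apply, hw]
  have hker : H = f.ker := by
    ext x
    rw [hH, AddMonoidHom.mem_ker]
    constructor
    · rintro ⟨y, rfl⟩
      funext i
      change PadicInt.toZMod (b.equivFun ((p : ℤ_[p]) • y) i) = 0
      simp
    · intro hx
      have h1 : ∀ i, ∃ c, b.equivFun x i = (p : ℤ_[p]) * c := by
        intro i
        have h2 : PadicInt.toZMod (b.equivFun x i) = 0 := congrFun hx i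
        rw [← RingHom.mem_ker, PadicInt.ker_toZMod, PadicInt.maximalIdeal_eq_span_p,
          Ideal.mem_span_singleton] at h2
        exact h2
      choose c hc using h1
      refine ⟨b.equivFun.symm c, b.equivFun.injective ?_⟩
      rw [map_smul, LinearEquiv.apply_symm_apply]
      funext i
      rw [hc i]; rfl
  rw [hker, AddSubgroup.index_ker, AddMonoidHom.range_eq_top.mpr hsurj]
  simp [Nat.card_eq_fintype_card]

theorem aux_finite_quot (p : ℕ) [Fact p.Prime] (k : ℕ) :
    Finite (ℤ_[p] ⧸ Ideal.span {(p : ℤ_[p]) ^ k}) := by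
  rw [← PadicInt.ker_toZModPow]
  have : NeZero (p ^ k) := ⟨pow_ne_zero _ (Fact.out : p.Prime).ne_zero⟩
  exact Finite.of_injective _ (RingHom.kerLift_injective (PadicInt.toZModPow (p := p) k))

theorem aux_card_pow (p : ℕ) [Fact p.Prime] (Q : Type*) [AddCommGroup Q] [Module ℤ_[p] Q]
    [Finite Q] : ∃ k, Nat.card Q = p ^ k := by
  refine ⟨_, Nat.eq_prime_pow_of_unique_prime_dvd (p := p) Nat.card_pos.ne' ?_⟩
  intro q hq hd
  by_contra hne
  have := Fact.mk hq
  obtain ⟨x, hx⟩ := exists_prime_addOrderOf_dvd_card' (G := Q) q hd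
  have h0 : (q : ℤ_[p]) • x = 0 := by
    rw [Nat.cast_smul_eq_nsmul, ← hx, addOrderOf_nsmul_eq_zero]
  have hu : IsUnit (q : ℤ_[p]) := by
    rw [PadicInt.isUnit_iff]
    apply le_antisymm (PadicInt.norm_le_one _)
    rw [← not_lt, PadicInt.norm_lt_one_iff_dvd]
    intro h
    have : (PadicInt.toZMod (p := p) (q : ℤ_[p])) = 0 := by
      rw [← RingHom.mem_ker, PadicInt.ker_toZMod, PadicInt.maximalIdeal_eq_span_p,
          Ideal.mem_span_singleton]
      exact h
    rw [map_natCast, ZMod.natCast_eq_zero_iff] at this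
    exact hne ((Nat.prime_dvd_prime_iff_eq Fact.out hq).mp this).symm
  rw [hu.smul_eq_zero] at h0
  rw [h0, addOrderOf_zero] at hx
  exact hq.one_lt.ne hx

theorem aux_torsion (p : ℕ) [Fact p.Prime] (M : Type*) [AddCommGroup M] [Module ℤ_[p] M]
    [Module.Finite ℤ_[p] M] : ∃ k : ℕ, ∀ (x : M) (b : ℤ_[p]), b ≠ 0 → b • x = 0 →
      (p : ℤ_[p]) ^ k • x = 0 := by
  obtain ⟨a, ha⟩ := Submodule.annihilator_top_inter_nonZeroDivisors
    (R := ℤ_[p]) (M := Submodule.torsion ℤ_[p] M) Submodule.torsion_isTorsion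
  have ha0 : a ≠ 0 := nonZeroDivisors.ne_zero ha.2
  refine ⟨a.valuation, fun x b hb hx => ?_⟩
  have hxt : x ∈ Submodule.torsion ℤ_[p] M :=
    (Submodule.mem_torsion_iff x).mpr ⟨⟨b, mem_nonZeroDivisors_of_ne_zero hb⟩, hx⟩
  have h1 := Submodule.mem_annihilator.mp ha.1 ⟨x, hxt⟩ trivial
  have h2 : a • x = 0 := congrArg Subtype.val h1
  rw [PadicInt.unitCoeff_spec ha0, mul_smul] at h2
  exact (Units.isUnit _).smul_eq_zero.mp h2

theorem aux_small (p : ℕ) [Fact p.Prime]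
    (M : Type*) [AddCommGroup M] [Module (PowerSeries ℤ_[p]) M]
    [Module ℤ_[p] M] [IsScalarTower ℤ_[p] (PowerSeries ℤ_[p]) M]
    [Module.Finite ℤ_[p] M]
    (ω Φ : ℕ → PowerSeries ℤ_[p]) (hΦ : ∀ n, ω (n+1) = Φ n * ω n)
    (hJ : ∀ n, ¬ IsUnit (Φ n)) (k : ℕ) :
    ∃ N, ∀ n ≥ N, ∀ x : M, ∃ y : M, ω n • x = (p : ℤ_[p]) ^ k • y := by
  let P : Submodule (PowerSeries ℤ_[p]) M := 
    { carrier := {x | ∃ y : M, (p : ℤ_[p]) ^ k • y = x}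
      zero_mem' := ⟨0, by simp⟩
      add_mem' := by
        rintro _ _ ⟨y, rfl⟩ ⟨z, rfl⟩
        exact ⟨y + z, by simp⟩
      smul_mem' := by
        rintro c _ ⟨y, rfl⟩
        exact ⟨c • y, by rw [smul_comm]⟩ }
  have hP : P.restrictScalars ℤ_[p] = 
      (Ideal.span {(p : ℤ_[p]) ^ k} : Ideal ℤ_[p]) • (⊤ : Submodule ℤ_[p] M) := by
    ext x
    rw [Submodule.ideal_span_singleton_smul, Submodule.mem_smul_pointwise_iff_exists]
    simp [P]
  have hfQ : Finite (M ⧸ P) := by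
    have := aux_finite_quot p k
    have h1 : Finite (M ⧸ P.restrictScalars ℤ_[p]) := by
      rw [hP]
      exact Submodule.finite_quotient_smul _ Module.Finite.fg_top
    exact Finite.of_equiv _ (Submodule.Quotient.restrictScalarsEquiv ℤ_[p] P).toEquiv
  let F : ℕ →o (Submodule (PowerSeries ℤ_[p]) (M ⧸ P))ᵒᵈ :=
    { toFun := fun n => OrderDual.toDual ((Ideal.span {ω n}) • ⊤)
      monotone' := by
        apply monotone_nat_of_le_succ
        intro n
        rw [OrderDual.toDual_le_toDual]
        apply Submodule.smul_mono_left
        rw [Ideal.span_singleton_le_span_singleton, hΦ]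
        exact dvd_mul_left _ _ }
  obtain ⟨N, hN⟩ := IsArtinian.monotone_stabilizes F
  have hbot : (Ideal.span {ω N}) • (⊤ : Submodule (PowerSeries ℤ_[p]) (M ⧸ P)) = ⊥ := by
    apply Submodule.eq_bot_of_le_smul_of_le_jacobson_bot (Ideal.span {Φ N}) _ (IsNoetherian.noetherian _)
    · have h := OrderDual.toDual.injective (hN (N+1) (Nat.le_succ N))
      rw [hΦ, ← Ideal.span_singleton_mul_span_singleton, ← smul_eq_mul, smul_assoc] at h
      exact h.le
    · rw [IsLocalRing.jacobson_eq_maximalIdeal ⊥ bot_ne_top, Ideal.span_singleton_le_iff_mem]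
      exact hJ N
  refine ⟨N, fun n hn x => ?_⟩
  have h := OrderDual.toDual.injective (hN n hn)
  have h2 : ω n • (P.mkQ x) ∈ (Ideal.span {ω n}) • (⊤ : Submodule (PowerSeries ℤ_[p]) (M ⧸ P)) :=
    Submodule.smul_mem_smul (Ideal.mem_span_singleton_self _) trivial
  rw [← h, hbot, Submodule.mem_bot, ← map_smul, Submodule.mkQ_apply, Submodule.Quotient.mk_eq_zero] at h2
  obtain ⟨y, hy⟩ := h2
  exact ⟨y, hy.symm⟩

theorem aux_phi_eq (p : ℕ) [Fact p.Prime]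
    (M : Type*) [AddCommGroup M] [Module (PowerSeries ℤ_[p]) M]
    [Module ℤ_[p] M] [IsScalarTower ℤ_[p] (PowerSeries ℤ_[p]) M]
    [Module.Finite ℤ_[p] M] (w φ c : PowerSeries ℤ_[p]) (hc : φ = p + w * c) (k : ℕ)
    (hw : ∀ x : M, ∃ y : M, w • x = (p : ℤ_[p]) ^ (k + 2) • y) :
    (Ideal.span {φ}) • (⊤ : Submodule (PowerSeries ℤ_[p]) M) =
      (Ideal.span {(p : PowerSeries ℤ_[p])}) • ⊤ := by
  have hnoe : IsNoetherian (PowerSeries ℤ_[p]) M := isNoetherian_of_tower ℤ_[p] inferInstance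
  have hw' : ∀ x : M, ∃ y : M,
      w • x = (p : PowerSeries ℤ_[p]) • (p : PowerSeries ℤ_[p]) • y := by
    intro x
    obtain ⟨y, hy⟩ := hw x
    refine ⟨(p : ℤ_[p]) ^ k • y, ?_⟩
    rw [hy, Nat.cast_smul_eq_nsmul, Nat.cast_smul_eq_nsmul, ← Nat.cast_smul_eq_nsmul ℤ_[p],
      ← Nat.cast_smul_eq_nsmul ℤ_[p], smul_smul, smul_smul]
    congr 1
    ring
  apply le_antisymm
  · intro z hz
    rw [Submodule.ideal_span_singleton_smul, Submodule.mem_smul_pointwise_iff_exists] at hz ⊢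
    obtain ⟨x, -, rfl⟩ := hz
    obtain ⟨y, hy⟩ := hw' (c • x)
    refine ⟨x + (p : PowerSeries ℤ_[p]) • y, trivial, ?_⟩
    rw [hc, add_smul, mul_smul, hy, smul_add]
  · apply Submodule.le_of_le_smul_of_le_jacobson_bot
      (I := Ideal.span {(p : PowerSeries ℤ_[p])}) (IsNoetherian.noetherian _)
    · rw [IsLocalRing.jacobson_eq_maximalIdeal ⊥ bot_ne_top, Ideal.span_singleton_le_iff_mem,
        IsLocalRing.mem_maximalIdeal, mem_nonunits_iff, PowerSeries.isUnit_iff_constantCoeff,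
        map_natCast]
      exact PadicInt.irreducible_p.not_isUnit
    · intro z hz
      rw [Submodule.ideal_span_singleton_smul, Submodule.mem_smul_pointwise_iff_exists] at hz
      obtain ⟨x, -, rfl⟩ := hz
      obtain ⟨y, hy⟩ := hw' (c • x)
      have h1 : (p : PowerSeries ℤ_[p]) • x
          = φ • x + (p : PowerSeries ℤ_[p]) • (p : PowerSeries ℤ_[p]) • (-y) := by
        rw [hc, add_smul, mul_smul, hy]
        simp
      rw [h1]
      apply Submodule.add_mem_sup
      · exact Submodule.smul_mem_smul (Ideal.mem_span_singleton_self _) trivial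
      · exact Submodule.smul_mem_smul (Ideal.mem_span_singleton_self _)
          (Submodule.smul_mem_smul (Ideal.mem_span_singleton_self _) trivial)

theorem aux_finrank (p : ℕ) [Fact p.Prime] (M : Type*) [AddCommGroup M] [Module ℤ_[p] M]
    [Module.Finite ℤ_[p] M] (L : Submodule ℤ_[p] M) [Finite (M ⧸ L)] :
    Module.finrank ℤ_[p] L = Module.finrank ℤ_[p] M := by
  have h := L.finrank_quotient_add_finrank
  have h0 : Module.finrank ℤ_[p] (M ⧸ L) = 0 := by
    rw [Module.finrank_eq_zero_iff]
    intro x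
    refine ⟨(Nat.card (M ⧸ L) : ℤ_[p]), ?_, ?_⟩
    · exact_mod_cast Nat.card_pos.ne'
    · rw [Nat.cast_smul_eq_nsmul]
      exact card_nsmul_eq_zero'
  omega

theorem aux_step (p : ℕ) [Fact p.Prime]
    (M : Type*) [AddCommGroup M] [Module (PowerSeries ℤ_[p]) M]
    [Module ℤ_[p] M] [IsScalarTower ℤ_[p] (PowerSeries ℤ_[p]) M]
    [Module.Finite ℤ_[p] M] (w φ c : PowerSeries ℤ_[p]) (hc : φ = p + w * c) (k : ℕ)
    (hk : ∀ (x : M) (b : ℤ_[p]), b ≠ 0 → b • x = 0 → (p : ℤ_[p]) ^ k • x = 0)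
    (hw : ∀ x : M, ∃ y : M, w • x = (p : ℤ_[p]) ^ (k + 2) • y)
    (hfin : Finite (M ⧸ ((Ideal.span {w}) • (⊤ : Submodule (PowerSeries ℤ_[p]) M)))) :
    Nat.card (M ⧸ ((Ideal.span {φ * w}) • (⊤ : Submodule (PowerSeries ℤ_[p]) M))) =
      p ^ Module.finrank ℤ_[p] M *
        Nat.card (M ⧸ ((Ideal.span {w}) • (⊤ : Submodule (PowerSeries ℤ_[p]) M))) := by
  have hW : (Ideal.span {φ * w}) • (⊤ : Submodule (PowerSeries ℤ_[p]) M) =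
      (Ideal.span {(p : PowerSeries ℤ_[p])}) • (Ideal.span {w}) • ⊤ := by
    rw [mul_comm, ← Ideal.span_singleton_mul_span_singleton, ← smul_eq_mul, smul_assoc,
      aux_phi_eq p M w φ c hc k hw, ← smul_assoc, ← smul_assoc, smul_eq_mul, smul_eq_mul, mul_comm]
  rw [hW]
  have hmem : ∀ z : M, z ∈ (Ideal.span {w}) • (⊤ : Submodule (PowerSeries ℤ_[p]) M) →
      ∃ x, w • x = z := by
    intro z hz
    rw [Submodule.ideal_span_singleton_smul, Submodule.mem_smul_pointwise_iff_exists] at hz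
    obtain ⟨x, -, h⟩ := hz
    exact ⟨x, h⟩
  generalize (Ideal.span {w}) • (⊤ : Submodule (PowerSeries ℤ_[p]) M) = A at *
  have hle : (Ideal.span {(p : PowerSeries ℤ_[p])}) • A ≤ A := Submodule.smul_le_right
  have hfin' : Finite (M ⧸ A.restrictScalars ℤ_[p]) :=
    Finite.of_equiv _ (Submodule.Quotient.restrictScalarsEquiv ℤ_[p] A).symm.toEquiv
  have htf : Module.IsTorsionFree ℤ_[p] (A.restrictScalars ℤ_[p]) := by
    rw [Module.isTorsionFree_iff_smul_eq_zero]
    rintro b ⟨z, hz⟩ hbz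
    by_contra! hcon
    obtain ⟨hb, hne⟩ := hcon
    apply hne
    have h1 : b • z = 0 := congrArg Subtype.val hbz
    obtain ⟨x, rfl⟩ := hmem z hz
    obtain ⟨y, hy⟩ := hw x
    have hp0 : (p : ℤ_[p]) ≠ 0 := by exact_mod_cast (Fact.out : p.Prime).ne_zero
    rw [hy, smul_smul] at h1
    have h2 := hk y _ (mul_ne_zero hb (pow_ne_zero _ hp0)) h1
    apply Subtype.ext
    change w • x = 0
    rw [hy, add_comm, pow_add, mul_smul, h2, smul_zero]
  have hidx := AddSubgroup.relIndex_mul_index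
    (H := ((Ideal.span {(p : PowerSeries ℤ_[p])}) • A).toAddSubgroup) (K := A.toAddSubgroup) hle
  have hrel : ((Ideal.span {(p : PowerSeries ℤ_[p])}) • A).toAddSubgroup.relIndex A.toAddSubgroup
      = p ^ Module.finrank ℤ_[p] M := by
    rw [← aux_finrank p M (A.restrictScalars ℤ_[p])]
    apply aux_index_free p (A.restrictScalars ℤ_[p])
    rintro ⟨z, hz⟩
    change z ∈ (Ideal.span {(p : PowerSeries ℤ_[p])}) • A ↔ _
    rw [Submodule.ideal_span_singleton_smul, Submodule.mem_smul_pointwise_iff_exists]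
    constructor
    · rintro ⟨y, hy, h⟩
      refine ⟨⟨y, hy⟩, Subtype.ext ?_⟩
      rw [Nat.cast_smul_eq_nsmul] at h
      rw [Nat.cast_smul_eq_nsmul]
      exact h
    · rintro ⟨⟨y, hy⟩, h⟩
      refine ⟨y, hy, ?_⟩
      rw [Nat.cast_smul_eq_nsmul] at h
      rw [Nat.cast_smul_eq_nsmul]
      exact congrArg Subtype.val h
  rw [hrel] at hidx
  exact hidx.symm



/-- Let `Λ = ℤ_p⟦T⟧`, `ω n = (1+T)^(p^n) - 1`, and let `M` be a `Λ`-module which is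
finitely generated of rank `λ` as a `ℤ_p`-module, with `M/ωₙM` finite for all `n`.
Then there are `ν : ℤ` and `N` such that `#(M/ωₙM) = p^(λ n + ν)` for all `n ≥ N`. -/
theorem card_quotient_eq_pow_lambda_mul_add
    (p : ℕ) [Fact p.Prime]
    (M : Type*) [AddCommGroup M] [Module (PowerSeries ℤ_[p]) M]
    [Module ℤ_[p] M] [IsScalarTower ℤ_[p] (PowerSeries ℤ_[p]) M]
    [Module.Finite ℤ_[p] M]
    (l : ℕ) (hl : Module.finrank ℤ_[p] M = l)
    (ω : ℕ → PowerSeries ℤ_[p])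
    (hω : ∀ n, ω n = (1 + PowerSeries.X) ^ p ^ n - 1)
    (hfin : ∀ n : ℕ,
      Finite (M ⧸ ((Ideal.span {ω n} : Ideal (PowerSeries ℤ_[p])) • (⊤ : Submodule (PowerSeries ℤ_[p]) M)))) :
    ∃ (ν : ℤ) (N : ℕ), ∀ n ≥ N,
      (Nat.card (M ⧸ ((Ideal.span {ω n} : Ideal (PowerSeries ℤ_[p])) • (⊤ : Submodule (PowerSeries ℤ_[p]) M))) : ℝ)
        = (p : ℝ) ^ ((l : ℤ) * n + ν) := by
  have hp : p.Prime := Fact.out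
  let Φ : ℕ → PowerSeries ℤ_[p] := fun n => ∑ i ∈ Finset.range p, (1 + ω n) ^ i
  have hΦ : ∀ n, ω (n + 1) = Φ n * ω n := by
    intro n
    have h := geom_sum_mul (1 + ω n) p
    rw [add_sub_cancel_left] at h
    change _ = (∑ i ∈ Finset.range p, (1 + ω n) ^ i) * ω n
    rw [h, hω, hω, add_sub_cancel, ← pow_mul, ← pow_succ]
  have hc : ∀ n, ∃ c, Φ n = p + ω n * c := by
    intro n
    have h1 : ω n ∣ Φ n - p := by
      have h2 : Φ n - p = ∑ i ∈ Finset.range p, ((1 + ω n) ^ i - 1) := by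
        simp [Φ]
      rw [h2]
      apply Finset.dvd_sum
      intro i _
      have := sub_dvd_pow_sub_pow (1 + ω n) 1 i
      simpa using this
    obtain ⟨c, hc⟩ := h1
    exact ⟨c, by rw [← hc]; ring⟩
  choose c hc using hc
  have hJ : ∀ n, ¬ IsUnit (Φ n) := by
    intro n
    rw [PowerSeries.isUnit_iff_constantCoeff, hc, hω]
    simpa using PadicInt.irreducible_p.not_isUnit
  obtain ⟨k, hk⟩ := aux_torsion p M
  obtain ⟨N, hN⟩ := aux_small p M ω Φ hΦ hJ (k + 2)
  obtain ⟨e, he⟩ : ∃ e, Nat.card (M ⧸ ((Ideal.span {ω N} : Ideal (PowerSeries ℤ_[p])) •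
      (⊤ : Submodule (PowerSeries ℤ_[p]) M))) = p ^ e := by
    have := hfin N
    exact aux_card_pow p _
  have key : ∀ m, Nat.card (M ⧸ ((Ideal.span {ω (N + m)} : Ideal (PowerSeries ℤ_[p])) •
      (⊤ : Submodule (PowerSeries ℤ_[p]) M))) = p ^ (l * m + e) := by
    intro m
    induction m with
    | zero => simpa using he
    | succ m ih =>
      rw [← add_assoc, hΦ, aux_step p M (ω (N + m)) (Φ (N + m)) _ (hc _) k hk
        (hN _ (Nat.le_add_right _ _)) (hfin _), ih, hl, ← pow_add]
      congr 1
      ring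
  refine ⟨e - l * N, N, fun n hn => ?_⟩
  obtain ⟨m, rfl⟩ := Nat.exists_eq_add_of_le hn
  rw [key, Nat.cast_pow, ← zpow_natCast]
  congr 1
  push_cast
  ring
end

section
/- Let A be a Dedekind domain with fraction field K, let L/K be a finite Galois extension of fields with Galois group G, and let B be the integral closure of A in L, which is a Dedekind domain stable under the action of G. Suppose that every crossed homomorphism c : G → Bˣ (i.e., every map satisfying c(στ) = c(σ)·σ(c(τ)) for all σ, τ ∈ G) is principal, meaning there exists a unit u ∈ Bˣ with c(σ) = σ(u)·u⁻¹ for all σ ∈ G. Then every nonzero ideal I of A whose extension I·B is a principal ideal of B is itself a principal ideal of A. -/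
/-- Let `A` be a Dedekind domain with fraction field `K`, `L/K` a finite Galois
extension with Galois group `G`, and `B` the integral closure of `A` in `L`,
a Dedekind domain stable under `G` (the action of `σ : L ≃ₐ[K] L` on `B` being
`galRestrict A K L B σ`).  If every crossed homomorphism `c : G → Bˣ` is
principal, then every nonzero ideal `I` of `A` whose extension `I·B` is
principal is itself principal. -/
theorem isPrincipal_of_extension_isPrincipal
    (A K L B : Type*) [CommRing A] [IsDedekindDomain A] [Field K] [Field L]
    [CommRing B] [IsDedekindDomain B]
    [Algebra A K] [IsFractionRing A K]
    [Algebra K L] [FiniteDimensional K L] [IsGalois K L]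
    [Algebra A B] [Algebra B L] [Algebra A L]
    [IsScalarTower A B L] [IsScalarTower A K L]
    [IsIntegralClosure B A L]
    (hcrossed : ∀ c : (L ≃ₐ[K] L) → Bˣ,
      (∀ σ τ : L ≃ₐ[K] L, (c (σ * τ) : B) = (c σ : B) * galRestrict A K L B σ (c τ : B)) →
      ∃ u : Bˣ, ∀ σ : L ≃ₐ[K] L, (c σ : B) = galRestrict A K L B σ (u : B) * ((u⁻¹ : Bˣ) : B)) :
    ∀ I : Ideal A, I ≠ ⊥ → (I.map (algebraMap A B)).IsPrincipal → I.IsPrincipal := by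
  intro I hI0 hI
  have hinjBL : Function.Injective (algebraMap B L) := IsIntegralClosure.algebraMap_injective B A L
  have hinjAL : Function.Injective (algebraMap A L) := by
    rw [IsScalarTower.algebraMap_eq A K L]
    exact (algebraMap K L).injective.comp (IsFractionRing.injective A K)
  have hinjAB : Function.Injective (algebraMap A B) := by
    rw [IsScalarTower.algebraMap_eq A B L] at hinjAL
    exact Function.Injective.of_comp hinjAL
  haveI : FaithfulSMul A B := (faithfulSMul_iff_algebraMap_injective A B).2 hinjAB
  haveI : Module.IsTorsionFree A B := inferInstance
  haveI : Algebra.IsIntegral A B := IsIntegralClosure.isIntegral_algebra A L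
  haveI : Module.FaithfullyFlat A B := inferInstance
  obtain ⟨α, hα⟩ := hI
  change _ = Ideal.span {α} at hα
  have hα0 : α ≠ 0 := by
    rintro rfl
    apply hI0
    rw [Ideal.span_singleton_eq_bot.2 rfl] at hα
    exact (Ideal.map_eq_bot_iff_of_injective hinjAB).1 hα
  have hassoc : ∀ σ : L ≃ₐ[K] L, ∃ v : Bˣ, (v : B) * α = galRestrict A K L B σ α := by
    intro σ
    have h1 : Ideal.span {α} = Ideal.span {galRestrict A K L B σ α} := by
      have h2 := congrArg (Ideal.map ((galRestrict A K L B σ : B →ₐ[A] B) : B →+* B)) hα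
      rw [Ideal.map_map, Ideal.map_span, Set.image_singleton, AlgHom.comp_algebraMap, hα] at h2
      exact h2
    obtain ⟨v, hv⟩ := Ideal.span_singleton_eq_span_singleton.1 h1
    exact ⟨v, by rw [mul_comm]; exact hv⟩
  choose c hc using hassoc
  obtain ⟨u, hu⟩ := hcrossed c (by
    intro σ τ
    apply mul_right_cancel₀ hα0
    rw [hc, map_mul, AlgEquiv.mul_apply, ← hc τ, map_mul, ← hc σ]
    ring)
  set β : B := α * ((u⁻¹ : Bˣ) : B) with hβ
  have hβu : β * u = α := by simp [hβ, mul_assoc]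
  have hfix : ∀ σ : L ≃ₐ[K] L, galRestrict A K L B σ β = β := by
    intro σ
    have hu0 : galRestrict A K L B σ (u : B) ≠ 0 := by simp
    apply mul_right_cancel₀ hu0
    rw [← map_mul, hβu, ← hc σ, hu σ, hβ]
    ring
  have hmem : algebraMap B L β ∈ Set.range (algebraMap K L) := by
    rw [IsGalois.mem_range_algebraMap_iff_fixed]
    intro σ
    rw [← algebraMap_galRestrict_apply A, hfix]
  obtain ⟨k, hk⟩ := hmem
  have hint : IsIntegral A k := by
    rw [← isIntegral_algebraMap_iff (algebraMap K L).injective, hk]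
    exact (Algebra.IsIntegral.isIntegral β).algebraMap
  obtain ⟨a, rfl⟩ := IsIntegrallyClosed.isIntegral_iff.1 hint
  have ha : algebraMap A B a = β := by
    apply hinjBL
    rw [← hk, ← IsScalarTower.algebraMap_apply, ← IsScalarTower.algebraMap_apply]
  refine ⟨a, ?_⟩
  change I = Ideal.span {a}
  rw [← Ideal.comap_map_eq_self_of_faithfullyFlat (B := B) I,
    ← Ideal.comap_map_eq_self_of_faithfullyFlat (B := B) (Ideal.span {a}), hα, Ideal.map_span,
    Set.image_singleton, ha]
  congr 1
  exact Ideal.span_singleton_eq_span_singleton.2 ⟨u⁻¹, rfl⟩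
end

section
/- Let k ⊆ k' be finite fields of odd characteristic, and let f ∈ k[T] be a squarefree polynomial of odd degree. Set R = k[T][x]/(x² − f) and R' = k'[T][x]/(x² − f), with the natural inclusion R ⊆ R'. Then every nonzero ideal I of R whose extension I·R' is a principal ideal of R' is itself a principal ideal of R. In particular, the induced map on ideal class groups Cl(R) → Cl(R') is injective, and hence so is its restriction to p-primary parts for every prime p. -/
open Polynomial

namespace ConstExt

section lmap
variable {k k' : Type*} [Field k] [Field k'] [Algebra k k']


noncomputable def lm (l : k' →ₗ[k] k) (p : k'[X]) : k[X] :=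
  ∑ i ∈ Finset.range (p.natDegree + 1), monomial i (l (p.coeff i))

lemma coeff_lm (l : k' →ₗ[k] k) (p : k'[X]) (n : ℕ) : (lm l p).coeff n = l (p.coeff n) := by
  unfold lm
  rw [finsetSum_coeff]
  simp only [coeff_monomial]
  rw [Finset.sum_ite_eq']
  split_ifs with h
  · rfl
  · rw [coeff_eq_zero_of_natDegree_lt (by simpa using h), map_zero]

lemma lm_add (l : k' →ₗ[k] k) (p q : k'[X]) : lm l (p + q) = lm l p + lm l q := by
  ext n; simp [coeff_lm]

lemma lm_map_mul (l : k' →ₗ[k] k) (a : k[X]) (p : k'[X]) :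
    lm l (a.map (algebraMap k k') * p) = a * lm l p := by
  ext n
  simp only [coeff_lm, coeff_mul, map_sum, coeff_map]
  refine Finset.sum_congr rfl fun x _ => ?_
  rw [← Algebra.smul_def, map_smul, smul_eq_mul]

lemma lm_map (l : k' →ₗ[k] k) (h1 : l 1 = 1) (a : k[X]) :
    lm l (a.map (algebraMap k k')) = a := by
  ext n
  rw [coeff_lm, coeff_map, Algebra.algebraMap_eq_smul_one, map_smul, h1]
  simp

lemma degree_lm_le (l : k' →ₗ[k] k) (p : k'[X]) : (lm l p).degree ≤ p.degree := by
  rw [degree_le_iff_coeff_zero]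
  intro m hm
  rw [coeff_lm, coeff_eq_zero_of_degree_lt hm, map_zero]

lemma exists_functional (c : k') (hc : c ≠ 0) : ∃ l : k' →ₗ[k] k, l c = 1 := by
  have h : ∃ l : Module.Dual k k', l c ≠ 0 := by
    by_contra! h
    exact hc ((Module.forall_dual_apply_eq_zero_iff k c).1 h)
  obtain ⟨l, hl⟩ := h
  exact ⟨(l c)⁻¹ • l, by simp [hl]⟩

end lmap

section quad
variable {K : Type*} [Field K] (f : K[X])

lemma monic_quad : (X ^ 2 - C f : (K[X])[X]).Monic := monic_X_pow_sub_C f (by norm_num)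

/-- The element `a + b x`. -/
noncomputable def el (a b : K[X]) : AdjoinRoot (X ^ 2 - C f : (K[X])[X]) :=
  AdjoinRoot.of _ a + AdjoinRoot.of _ b * AdjoinRoot.root _

lemma root_sq : (AdjoinRoot.root (X ^ 2 - C f : (K[X])[X])) ^ 2 = AdjoinRoot.of _ f := by
  have h := AdjoinRoot.eval₂_root (X ^ 2 - C f : (K[X])[X])
  simpa [sub_eq_zero] using h

lemma el_mul (a b c d : K[X]) :
    el f a b * el f c d = el f (a * c + f * b * d) (a * d + b * c) := by
  simp only [el, map_add, map_mul]
  linear_combination (AdjoinRoot.of _ b * AdjoinRoot.of _ d) * root_sq f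

lemma el_add (a b c d : K[X]) : el f a b + el f c d = el f (a + c) (b + d) := by
  simp only [el, map_add]; ring

lemma el_eq_mk (a b : K[X]) : el f a b = AdjoinRoot.mk _ (C a + C b * X) := by
  simp [el]

/-- First coordinate. -/
noncomputable def c0 (z : AdjoinRoot (X ^ 2 - C f : (K[X])[X])) : K[X] :=
  (AdjoinRoot.modByMonicHom (monic_quad f) z).coeff 0

/-- Second coordinate. -/
noncomputable def c1 (z : AdjoinRoot (X ^ 2 - C f : (K[X])[X])) : K[X] :=
  (AdjoinRoot.modByMonicHom (monic_quad f) z).coeff 1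

lemma mod_el (a b : K[X]) :
    AdjoinRoot.modByMonicHom (monic_quad f) (el f a b) = C a + C b * X := by
  rw [el_eq_mk, AdjoinRoot.modByMonicHom_mk, (modByMonic_eq_self_iff (monic_quad f)).2]
  rw [degree_X_pow_sub_C (by norm_num), add_comm]
  exact lt_of_le_of_lt degree_linear_le (by norm_num)

@[simp] lemma c0_el (a b : K[X]) : c0 f (el f a b) = a := by simp [c0, mod_el]
@[simp] lemma c1_el (a b : K[X]) : c1 f (el f a b) = b := by simp [c1, mod_el]

lemma exists_el (z : AdjoinRoot (X ^ 2 - C f : (K[X])[X])) : ∃ a b, z = el f a b := by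
  refine ⟨c0 f z, c1 f z, ?_⟩
  rw [el_eq_mk]
  conv_lhs => rw [← AdjoinRoot.mk_leftInverse (monic_quad f) z]
  congr 1
  set p := AdjoinRoot.modByMonicHom (monic_quad f) z with hp
  have hd : p.natDegree ≤ 1 := by
    obtain ⟨q, rfl⟩ := AdjoinRoot.mk_surjective z
    rw [AdjoinRoot.modByMonicHom_mk] at hp
    have := degree_modByMonic_lt q (monic_quad f)
    rw [degree_X_pow_sub_C (by norm_num), ← hp] at this
    exact natDegree_le_of_degree_le (Order.le_of_lt_succ this)
  rw [add_comm]
  exact eq_X_add_C_of_natDegree_le_one hd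

lemma degree_norm (hdeg : Odd f.natDegree) (a b : K[X]) :
    (a ^ 2 - f * b ^ 2).degree = max (a ^ 2).degree (f * b ^ 2).degree := by
  have hf : f ≠ 0 := by rintro rfl; simp at hdeg
  rcases lt_trichotomy (a ^ 2).degree (f * b ^ 2).degree with h | h | h
  · rw [degree_sub_eq_right_of_degree_lt h, max_eq_right h.le]
  · by_cases hb : b = 0
    · simp [hb]
    · have ha : a ≠ 0 := by
        rintro rfl
        have h2 : (f * b ^ 2) ≠ 0 := mul_ne_zero hf (pow_ne_zero _ hb)
        rw [zero_pow two_ne_zero, degree_zero] at h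
        exact h2 (degree_eq_bot.1 h.symm)
      have h' := natDegree_eq_of_degree_eq h
      rw [natDegree_mul hf (pow_ne_zero _ hb), natDegree_pow, natDegree_pow] at h'
      obtain ⟨m, hm⟩ := hdeg
      omega
  · rw [degree_sub_eq_left_of_degree_lt h, max_eq_left h.le]

lemma norm_ne_zero (hdeg : Odd f.natDegree) (a b : K[X]) (h : ¬ (a = 0 ∧ b = 0)) :
    a ^ 2 - f * b ^ 2 ≠ 0 := by
  have hf : f ≠ 0 := by rintro rfl; simp at hdeg
  rw [← degree_ne_bot, degree_norm f hdeg]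
  intro h'
  rw [max_eq_bot, degree_eq_bot, degree_eq_bot] at h'
  simp [hf] at h'
  exact h h'

lemma const_of_norm (hdeg : Odd f.natDegree) (a b : K[X]) (h : (a ^ 2 - f * b ^ 2).degree ≤ 0) :
    b = 0 ∧ ∃ c, a = C c := by
  have hf : f ≠ 0 := by rintro rfl; simp at hdeg
  rw [degree_norm f hdeg, max_le_iff] at h
  constructor
  · by_contra hb
    have := natDegree_le_of_degree_le (n := 0) h.2
    rw [natDegree_mul hf (pow_ne_zero _ hb)] at this
    obtain ⟨m, hm⟩ := hdeg
    omega
  · have := natDegree_le_of_degree_le (n := 0) h.1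
    rw [natDegree_pow] at this
    exact ⟨_, eq_C_of_natDegree_eq_zero (by omega)⟩

end quad

theorem core
    {k k' : Type*} [Field k] [Field k'] [Algebra k k']
    (f : k[X]) (f' : k'[X]) (hf' : f' = f.map (algebraMap k k')) (hdeg : Odd f.natDegree)
    (φ : AdjoinRoot (X ^ 2 - C f : (k[X])[X]) →+* AdjoinRoot (X ^ 2 - C f' : (k'[X])[X]))
    (hφ₁ : ∀ a : k[X], φ (AdjoinRoot.of _ a) = AdjoinRoot.of _ (a.map (algebraMap k k')))
    (hφ₂ : φ (AdjoinRoot.root _) = AdjoinRoot.root _) :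
    ∀ I : Ideal (AdjoinRoot (X ^ 2 - C f : (k[X])[X])),
      I ≠ ⊥ → (I.map φ).IsPrincipal → I.IsPrincipal := by
  intro I hI ⟨g, hg⟩
  have hdeg' : Odd f'.natDegree := by rwa [hf', natDegree_map]
  have φel (a b : k[X]) : φ (el f a b) =
      el f' (a.map (algebraMap k k')) (b.map (algebraMap k k')) := by
    simp only [el, map_add, map_mul, hφ₁, hφ₂]
  -- the projections
  let P (l : k' →ₗ[k] k) (z : AdjoinRoot (X ^ 2 - C f' : (k'[X])[X])) :
      AdjoinRoot (X ^ 2 - C f : (k[X])[X]) := el f (lm l (c0 f' z)) (lm l (c1 f' z))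
  have Pel (l : k' →ₗ[k] k) (a b) : P l (el f' a b) = el f (lm l a) (lm l b) := by
    simp [P]
  have Padd (l : k' →ₗ[k] k) (y z) : P l (y + z) = P l y + P l z := by
    obtain ⟨a, b, rfl⟩ := exists_el f' y
    obtain ⟨c, d, rfl⟩ := exists_el f' z
    simp only [el_add, Pel, lm_add]
  have Pmul (l : k' →ₗ[k] k) (y z) : P l (φ y * z) = y * P l z := by
    obtain ⟨a, b, rfl⟩ := exists_el f y
    obtain ⟨c, d, rfl⟩ := exists_el f' z
    simp only [φel, el_mul, Pel, lm_add]
    rw [hf', ← Polynomial.map_mul]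
    simp only [lm_map_mul]
  have PI (l : k' →ₗ[k] k) : ∀ z ∈ I.map φ, P l z ∈ I := by
    intro z hz
    refine Submodule.span_induction (p := fun z _ => ∀ s, P l (s * z) ∈ I) ?_ ?_ ?_ ?_ hz 1 |>
      fun h => by simpa using h
    · rintro _ ⟨y, hy, rfl⟩ s
      rw [mul_comm, Pmul]
      exact I.mul_mem_right _ hy
    · intro s
      have := Pmul l 0 0
      simp only [map_zero, zero_mul] at this
      simp [this]
    · intro x y _ _ hx hy s
      rw [mul_add, Padd]
      exact I.add_mem (hx s) (hy s)
    · intro a x _ hx s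
      rw [smul_eq_mul, ← mul_assoc]
      exact hx _
  obtain ⟨m, hm⟩ := exists_functional (k := k) (1 : k') one_ne_zero
  have Pφ (y) : P m (φ y) = y := by
    obtain ⟨a, b, rfl⟩ := exists_el f y
    simp only [φel, Pel, lm_map m hm]
  have hmem : ∀ y ∈ I, ∃ s, φ y = g * s := by
    intro y hy
    have := Ideal.mem_map_of_mem φ hy
    rw [hg] at this
    obtain ⟨s, hs⟩ := Ideal.mem_span_singleton'.1 this
    exact ⟨s, by rw [← hs, mul_comm]⟩
  have hgI : g ∈ I.map φ := by rw [hg]; exact Submodule.mem_span_singleton_self g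
  obtain ⟨a, b, rfl⟩ := exists_el f' g
  have hab : ¬ (a = 0 ∧ b = 0) := by
    rintro ⟨rfl, rfl⟩
    apply hI
    rw [eq_bot_iff]
    intro y hy
    obtain ⟨s, hs⟩ := hmem y hy
    have h0 : el f' (0 : k'[X]) 0 = 0 := by simp [el]
    have h1 := Pφ y
    rw [hs, h0, zero_mul, ← map_zero φ, Pφ] at h1
    rw [Ideal.mem_bot, h1]
  obtain ⟨l, hl⟩ : ∃ l : k' →ₗ[k] k, ¬ (lm l a = 0 ∧ lm l b = 0) := by
    have key : ∀ p : k'[X], p ≠ 0 → ∃ l : k' →ₗ[k] k, lm l p ≠ 0 := by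
      intro p hp
      obtain ⟨l, hl⟩ := exists_functional (k := k) p.leadingCoeff (leadingCoeff_ne_zero.2 hp)
      refine ⟨l, fun h => ?_⟩
      have := coeff_lm l p p.natDegree
      rw [h, coeff_natDegree, hl] at this
      simp at this
    by_cases ha : a = 0
    · obtain ⟨l, hl⟩ := key b (fun hb => hab ⟨ha, hb⟩)
      exact ⟨l, fun h => hl h.2⟩
    · obtain ⟨l, hl⟩ := key a ha
      exact ⟨l, fun h => hl h.1⟩
  have hhI := PI l _ hgI
  rw [Pel] at hhI
  obtain ⟨r, hr⟩ := hmem _ hhI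
  obtain ⟨c, d, rfl⟩ := exists_el f' r
  rw [φel, el_mul] at hr
  have e0 := congrArg (c0 f') hr
  have e1 := congrArg (c1 f') hr
  simp only [c0_el, c1_el] at e0 e1
  set A := (lm l a).map (algebraMap k k') with hA
  set B := (lm l b).map (algebraMap k k') with hB
  have hAB : ¬ (A = 0 ∧ B = 0) := by
    rintro ⟨h1, h2⟩
    exact hl ⟨(Polynomial.map_eq_zero _).1 h1, (Polynomial.map_eq_zero _).1 h2⟩
  have hN : A ^ 2 - f' * B ^ 2 = (a ^ 2 - f' * b ^ 2) * (c ^ 2 - f' * d ^ 2) := by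
    rw [e0, e1]; ring
  have hle : (A ^ 2 - f' * B ^ 2).degree ≤ (a ^ 2 - f' * b ^ 2).degree := by
    have hAd : A.degree ≤ a.degree := by
      rw [hA, degree_map]; exact degree_lm_le l a
    have hBd : B.degree ≤ b.degree := by
      rw [hB, degree_map]; exact degree_lm_le l b
    rw [degree_norm f' hdeg', degree_norm f' hdeg']
    simp only [degree_mul, pow_two]
    gcongr
  have hn1 := norm_ne_zero f' hdeg' a b hab
  have hn2 := norm_ne_zero f' hdeg' A B hAB
  have hn3 : c ^ 2 - f' * d ^ 2 ≠ 0 := by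
    intro h; rw [h, mul_zero] at hN; exact hn2 hN
  have hle' : (c ^ 2 - f' * d ^ 2).degree ≤ 0 := by
    have h1 := natDegree_le_natDegree hle
    rw [hN, natDegree_mul hn1 hn3] at h1
    exact natDegree_eq_zero_iff_degree_le_zero.1 (by omega)
  obtain ⟨rfl, u, rfl⟩ := const_of_norm f' hdeg' c d hle'
  have hu : u ≠ 0 := by rintro rfl; simp at hn3
  refine ⟨el f (lm l a) (lm l b), le_antisymm ?_ ?_⟩
  · intro y hy
    obtain ⟨s, hs⟩ := hmem y hy
    refine Ideal.mem_span_singleton'.2 ⟨P m (el f' (C u⁻¹) 0 * s), ?_⟩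
    rw [mul_comm, ← Pmul, φel, ← hA, ← hB, ← mul_assoc, el_mul, e0, e1]
    conv_rhs => rw [← Pφ y, hs]
    have hC : (C u * C u⁻¹ : k'[X]) = 1 := by rw [← C_mul, mul_inv_cancel₀ hu, C_1]
    congr 3
    · linear_combination a * hC
    · linear_combination b * hC
  · exact (Ideal.span_singleton_le_iff_mem I).2 hhI

end ConstExt

/-- Let `k ⊆ k'` be finite fields of odd characteristic and `f ∈ k[T]` squarefree of
odd degree.  Let `R = k[T][x]/(x² - f)`, `R' = k'[T][x]/(x² - f)` and let
`φ : R →+* R'` be the natural inclusion (characterized by its values on `k[T]`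
and on the root).  Then every nonzero ideal `I` of `R` whose extension `I·R'`
is principal is itself principal; in particular the induced map on ideal class
groups (hence on their `p`-primary parts) is injective. -/
theorem isPrincipal_of_constant_extension_isPrincipal
    {k k' : Type*} [Field k] [Field k'] [Fintype k] [Fintype k'] [Algebra k k']
    (hchar : ringChar k ≠ 2)
    (f : k[X]) (hf : Squarefree f) (hdeg : Odd f.natDegree)
    (φ : AdjoinRoot (X ^ 2 - C f : (k[X])[X]) →+*
         AdjoinRoot (X ^ 2 - C (f.map (algebraMap k k')) : (k'[X])[X]))
    (hφ₁ : ∀ a : k[X], φ (AdjoinRoot.of _ a) = AdjoinRoot.of _ (a.map (algebraMap k k')))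
    (hφ₂ : φ (AdjoinRoot.root _) = AdjoinRoot.root _) :
    ∀ I : Ideal (AdjoinRoot (X ^ 2 - C f : (k[X])[X])),
      I ≠ ⊥ → (I.map φ).IsPrincipal → I.IsPrincipal := by
  exact ConstExt.core f _ rfl hdeg φ hφ₁ hφ₂
end

section
/- Let p be an odd prime, let q be an odd prime power, and let f ∈ 𝔽_q[T] be a squarefree polynomial of odd degree. For n ≥ 0 let 𝔽_{q^{p^n}} denote the field with q^{p^n} elements containing 𝔽_q, and set R_n = 𝔽_{q^{p^n}}[T][x]/(x² − f). Then for all m ≥ n ≥ 0, the norm map is surjective on p-primary parts of class groups: for every nonzero ideal I of R_n whose class in Cl(R_n) has p-power order, there exists a nonzero ideal J of R_m whose class in Cl(R_m) has p-power order and such that the relative norm ideal N_{R_m/R_n}(J) lies in the same ideal class as I (i.e., there exist nonzero a, b ∈ R_n with a·N_{R_m/R_n}(J) = b·I as ideals). -/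
open Polynomial

set_option maxHeartbeats 1000000
set_option synthInstance.maxHeartbeats 400000


section PartA

open PowerSeries in
theorem aux_dvd_prod_sub_one {ι : Type*} (s : Finset ι) (a : ι → PowerSeries ℂ) (D : PowerSeries ℂ)
    (h : ∀ i ∈ s, D ∣ a i - 1) : D ∣ (∏ i ∈ s, a i) - 1 := by
  classical
  induction s using Finset.induction_on with
  | empty => simp
  | insert i s hi ih =>
    rw [Finset.prod_insert hi]
    have h1 := h i (by simp)
    have h2 := ih (fun j hj => h j (by simp [hj]))
    have : a i * ∏ j ∈ s, a j - 1 = (a i - 1) * ∏ j ∈ s, a j + ((∏ j ∈ s, a j) - 1) := by ring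
    rw [this]
    exact dvd_add (h1.mul_right _) h2

variable {A : Type*} [CommRing A] [IsDedekindDomain A]

open Classical in
noncomputable def LSer (deg : Ideal A → ℕ)
    (hfin : ∀ n, {I : Ideal A | I ≠ ⊥ ∧ deg I = n}.Finite) (g : Ideal A →* ℂ)
    (S : Set (Ideal A)) : PowerSeries ℂ :=
  PowerSeries.mk fun n => ∑ I ∈ (hfin n).toFinset with (∀ P, Prime P → P ∣ I → P ∈ S), g I

theorem LSer_insert (deg : Ideal A → ℕ)
    (hfin : ∀ n, {I : Ideal A | I ≠ ⊥ ∧ deg I = n}.Finite) (g : Ideal A →* ℂ)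
    (hmul : ∀ I J : Ideal A, I ≠ ⊥ → J ≠ ⊥ → deg (I * J) = deg I + deg J)
    (S : Set (Ideal A)) (P : Ideal A) (hP : Prime P) (hPS : P ∉ S) :
    LSer deg hfin g (insert P S) * (1 - PowerSeries.C (g P) * PowerSeries.X ^ deg P)
      = LSer deg hfin g S := by
  classical
  have hP0 : P ≠ ⊥ := hP.ne_zero
  ext n
  rw [mul_sub, mul_one, map_sub, mul_left_comm, PowerSeries.coeff_C_mul,
    PowerSeries.coeff_mul_X_pow']
  simp only [LSer, PowerSeries.coeff_mk]
  rw [sub_eq_iff_eq_add]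
  rw [← Finset.sum_filter_not_add_sum_filter _ (fun I => P ∣ I)]
  congr 1
  · apply Finset.sum_congr _ (fun _ _ => rfl)
    ext I
    simp only [Finset.mem_filter, Set.Finite.mem_toFinset, Set.mem_ofPred_eq, Set.mem_insert_iff]
    constructor
    · rintro ⟨⟨h1, h2⟩, h3⟩
      refine ⟨h1, fun Q hQ hQI => ?_⟩
      rcases h2 Q hQ hQI with rfl | h
      · exact absurd hQI h3
      · exact h
    · rintro ⟨h1, h2⟩
      exact ⟨⟨h1, fun Q hQ hQI => Or.inr (h2 Q hQ hQI)⟩, fun h => hPS (h2 P hP h)⟩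
  · split_ifs with hn
    · rw [Finset.mul_sum]
      symm
      apply Finset.sum_bij (fun I _ => P * I)
      · intro I hI
        simp only [Finset.mem_filter, Set.Finite.mem_toFinset, Set.mem_ofPred_eq,
          Set.mem_insert_iff] at hI ⊢
        refine ⟨⟨⟨mul_ne_zero hP0 hI.1.1, ?_⟩, fun Q hQ hQI => ?_⟩, dvd_mul_right _ _⟩
        · rw [hmul _ _ hP0 hI.1.1, hI.1.2]; omega
        · rcases hQ.dvd_or_dvd hQI with h | h
          · left
            exact associated_iff_eq.mp (hQ.associated_of_dvd hP h)
          · exact hI.2 Q hQ h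
      · intro I _ J _ h
        exact mul_left_cancel₀ hP.ne_zero h
      · intro I hI
        simp only [Finset.mem_filter, Set.Finite.mem_toFinset, Set.mem_ofPred_eq,
          Set.mem_insert_iff] at hI
        obtain ⟨⟨⟨h1, h2⟩, h3⟩, J, rfl⟩ := hI
        have hJ : J ≠ ⊥ := right_ne_zero_of_mul h1
        refine ⟨J, ?_, rfl⟩
        simp only [Finset.mem_filter, Set.Finite.mem_toFinset, Set.mem_ofPred_eq,
          Set.mem_insert_iff]
        refine ⟨⟨hJ, ?_⟩, fun Q hQ hQI => h3 Q hQ (hQI.mul_left _)⟩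
        rw [hmul _ _ hP0 hJ] at h2; omega
      · intro I _
        rw [map_mul]
    · rw [mul_zero]
      apply Finset.sum_eq_zero
      intro I hI
      simp only [Finset.mem_filter, Set.Finite.mem_toFinset, Set.mem_ofPred_eq,
          Set.mem_insert_iff] at hI
      obtain ⟨⟨⟨h1, h2⟩, h3⟩, J, rfl⟩ := hI
      have hJ : J ≠ ⊥ := right_ne_zero_of_mul h1
      rw [hmul _ _ hP0 hJ] at h2; omega

theorem LSer_finset (deg : Ideal A → ℕ)
    (hfin : ∀ n, {I : Ideal A | I ≠ ⊥ ∧ deg I = n}.Finite) (g : Ideal A →* ℂ)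
    (hmul : ∀ I J : Ideal A, I ≠ ⊥ → J ≠ ⊥ → deg (I * J) = deg I + deg J)
    (T : Finset (Ideal A)) (hT : ∀ P ∈ T, Prime P) :
    LSer deg hfin g (T : Set (Ideal A)) *
      ∏ P ∈ T, (1 - PowerSeries.C (g P) * PowerSeries.X ^ deg P) = 1 := by
  classical
  induction T using Finset.induction_on with
  | empty =>
    ext n
    simp only [Finset.prod_empty, mul_one, LSer, PowerSeries.coeff_mk, PowerSeries.coeff_one]
    have hone : deg 1 = 0 := by
      have := hmul 1 1 one_ne_zero one_ne_zero
      rw [mul_one] at this; omega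
    have key : ∀ I : Ideal A, I ≠ ⊥ → (∀ P, Prime P → P ∣ I → P ∈ ((∅ : Finset (Ideal A)) : Set (Ideal A))) → I = 1 := by
      intro I hI h
      by_contra h1
      obtain ⟨P, hP, hPI⟩ := WfDvdMonoid.exists_irreducible_factor (a := I)
        (by rwa [isUnit_iff_eq_one]) hI
      simpa using h P hP.prime hPI
    have : ({I ∈ (hfin n).toFinset | (∀ P, Prime P → P ∣ I → P ∈ ((∅ : Finset (Ideal A)) : Set (Ideal A)))} : Finset (Ideal A))
        = if n = 0 then {1} else ∅ := by
      ext I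
      simp only [Finset.mem_filter, Set.Finite.mem_toFinset, Set.mem_ofPred_eq]
      constructor
      · rintro ⟨⟨h1, h2⟩, h3⟩
        have := key I h1 h3
        subst this
        rw [hone] at h2
        simp [← h2]
      · intro h
        split_ifs at h with hn
        · rw [Finset.mem_singleton] at h
          subst h
          refine ⟨⟨one_ne_zero, by rw [hone, hn]⟩, fun P hP hP1 => ?_⟩
          exact absurd (isUnit_of_dvd_one hP1) hP.not_isUnit
        · simp at h
    rw [this]
    split_ifs
    · rw [Finset.sum_singleton, map_one]
    · simp
  | insert P T hPT ih =>
    rw [Finset.prod_insert hPT, ← mul_assoc, Finset.coe_insert,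
      LSer_insert deg hfin g hmul _ P (hT P (by simp)) (by simpa using hPT)]
    exact ih (fun Q hQ => hT Q (by simp [hQ]))

theorem aux_prod_root {r d : ℕ} (hr : 0 < r) {ζ : ℂ} (hζ : IsPrimitiveRoot ζ r) (c : ℂ)
    (hc : c ^ (r / r.gcd d) = 1) :
    ∏ i ∈ Finset.range r, (1 - PowerSeries.C (c * (ζ ^ i) ^ d) * (PowerSeries.X : PowerSeries ℂ) ^ d)
      = (1 - PowerSeries.X ^ (d * (r / r.gcd d))) ^ (r.gcd d) := by
  set G := r.gcd d with hG
  have hGpos : 0 < G := Nat.gcd_pos_of_pos_left _ hr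
  set f := r / G with hf
  have hrf : r = f * G := (Nat.div_mul_cancel (Nat.gcd_dvd_left r d)).symm
  have hfpos : 0 < f := Nat.pos_of_mul_pos_right (by rw [← hrf]; exact hr)
  have hprim : IsPrimitiveRoot (ζ ^ d) f := by
    obtain ⟨d', hd'⟩ := Nat.gcd_dvd_right r d
    have h1 : IsPrimitiveRoot (ζ ^ G) f := hζ.pow hr (by rw [mul_comm]; exact hrf)
    have h2 : ζ ^ d = (ζ ^ G) ^ d' := by rw [← pow_mul, ← hd']
    rw [h2]
    apply h1.pow_of_coprime
    have := Nat.coprime_div_gcd_div_gcd (m := r) (n := d) hGpos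
    rw [← hG, ← hf] at this
    have h3 : d / G = d' := by rw [hd', ← hG, Nat.mul_div_cancel_left _ hGpos]
    rw [h3] at this
    exact this.symm
  have hblock : ∏ i ∈ Finset.range f, (1 - PowerSeries.C (c * (ζ ^ i) ^ d) * (PowerSeries.X : PowerSeries ℂ) ^ d)
      = 1 - PowerSeries.X ^ (d * f) := by
    have hpr : IsPrimitiveRoot (PowerSeries.C (ζ ^ d) : PowerSeries ℂ) f :=
      hprim.map_of_injective (f := (PowerSeries.C : ℂ →+* PowerSeries ℂ)) PowerSeries.C_injective
    have := hpr.pow_sub_pow_eq_prod_sub_mul (1 : PowerSeries ℂ) (PowerSeries.C c * PowerSeries.X ^ d) hfpos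
    rw [mul_pow, ← map_pow, hc, one_pow, map_one, one_mul, ← pow_mul] at this
    rw [this]
    apply Finset.prod_bij (fun i _ => (PowerSeries.C (ζ ^ d) : PowerSeries ℂ) ^ i)
    · intro i _
      rw [Polynomial.mem_nthRootsFinset hfpos, ← pow_mul, mul_comm, pow_mul, hpr.pow_eq_one, one_pow]
    · intro i hi j hj h
      exact hpr.pow_inj (Finset.mem_range.mp hi) (Finset.mem_range.mp hj) h
    · intro b hb
      rw [Polynomial.mem_nthRootsFinset hfpos] at hb
      have : NeZero f := ⟨hfpos.ne'⟩
      obtain ⟨i, hi, h⟩ := hpr.eq_pow_of_pow_eq_one hb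
      exact ⟨i, Finset.mem_range.mpr hi, h⟩
    · intro i _
      rw [← map_pow, map_mul, ← pow_mul, ← pow_mul, mul_comm d i]
      ring
  rw [hrf, ← hblock]
  have hper : ∀ j i : ℕ, (ζ ^ (f * j + i)) ^ d = (ζ ^ i) ^ d := by
    intro j i
    have : (ζ ^ (f * j + i)) ^ d = ((ζ ^ d) ^ f) ^ j * (ζ ^ i) ^ d := by ring
    rw [this, hprim.pow_eq_one, one_pow, one_mul]
  clear_value f
  clear hblock
  generalize G = G'
  induction G' with
  | zero => simp
  | succ G ih =>
    rw [mul_add, mul_one, Finset.prod_range_add, ih, pow_succ]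
    simp only [hper]

/-- The support set of primes of degree at most `n`. -/
theorem exists_primes_finset (deg : Ideal A → ℕ)
    (hfin : ∀ n, {I : Ideal A | I ≠ ⊥ ∧ deg I = n}.Finite) (n : ℕ) :
    ∃ T : Finset (Ideal A), ∀ P, P ∈ T ↔ Prime P ∧ deg P ≤ n := by
  classical
  refine ⟨((Finset.range (n + 1)).biUnion fun i => (hfin i).toFinset).filter Prime, fun P => ?_⟩
  simp only [Finset.mem_filter, Finset.mem_biUnion, Finset.mem_range, Set.Finite.mem_toFinset,
    Set.mem_ofPred_eq]
  constructor
  · rintro ⟨⟨i, hi, h1, h2⟩, h3⟩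
    exact ⟨h3, by omega⟩
  · rintro ⟨h1, h2⟩
    exact ⟨⟨deg P, by omega, h1.ne_zero, rfl⟩, h1⟩

theorem LSer_prod_dvd (deg : Ideal A → ℕ)
    (hfin : ∀ n, {I : Ideal A | I ≠ ⊥ ∧ deg I = n}.Finite) (g : Ideal A →* ℂ)
    (hmul : ∀ I J : Ideal A, I ≠ ⊥ → J ≠ ⊥ → deg (I * J) = deg I + deg J)
    {r : ℕ} (hr : 0 < r) {ζ : ℂ} (hζ : IsPrimitiveRoot ζ r)
    (hg : ∀ P, Prime P → g P ^ (r / r.gcd (deg P)) = 1) (n : ℕ)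
    (T : Finset (Ideal A)) (hT : ∀ P, P ∈ T ↔ Prime P ∧ deg P ≤ n) :
    PowerSeries.X ^ (n + 1) ∣
      (∏ i ∈ Finset.range r, PowerSeries.rescale (ζ ^ i) (LSer deg hfin g Set.univ)) *
      (∏ P ∈ T, (1 - PowerSeries.X ^ (deg P * (r / r.gcd (deg P)))) ^ (r.gcd (deg P))) - 1 := by
  classical
  have hE := LSer_finset deg hfin g hmul T (fun P hP => ((hT P).mp hP).1)
  set E : PowerSeries ℂ := ∏ P ∈ T, (1 - PowerSeries.C (g P) * PowerSeries.X ^ deg P) with hEdef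
  have h1 : (PowerSeries.X : PowerSeries ℂ) ^ (n + 1) ∣
      LSer deg hfin g Set.univ - LSer deg hfin g (T : Set (Ideal A)) := by
    rw [PowerSeries.X_pow_dvd_iff]
    intro m hm
    rw [map_sub, sub_eq_zero]
    simp only [LSer, PowerSeries.coeff_mk]
    apply Finset.sum_congr _ (fun _ _ => rfl)
    apply Finset.filter_congr
    intro I hI
    simp only [Set.Finite.mem_toFinset, Set.mem_ofPred_eq] at hI
    simp only [Set.mem_univ, implies_true, true_iff]
    intro P hP hPI
    rw [Finset.mem_coe, hT]
    refine ⟨hP, ?_⟩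
    obtain ⟨J, rfl⟩ := hPI
    rw [hmul _ _ hP.ne_zero (right_ne_zero_of_mul hI.1)] at hI
    omega
  have h2 : (PowerSeries.X : PowerSeries ℂ) ^ (n + 1) ∣ LSer deg hfin g Set.univ * E - 1 := by
    rw [← hE, ← sub_mul]
    exact h1.mul_right _
  have h3 := aux_dvd_prod_sub_one (Finset.range r)
    (fun i => PowerSeries.rescale (ζ ^ i) (LSer deg hfin g Set.univ * E)) (PowerSeries.X ^ (n+1)) (by
      intro i _
      have := map_dvd (PowerSeries.rescale (ζ ^ i)) h2
      rw [map_sub, map_one] at this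
      refine dvd_trans ?_ this
      rw [map_pow, PowerSeries.rescale_X, mul_pow]
      exact dvd_mul_left _ _)
  simp only [map_mul, Finset.prod_mul_distrib] at h3
  convert h3 using 3
  simp only [hEdef, map_prod]
  rw [Finset.prod_comm]
  apply Finset.prod_congr rfl
  intro P hP
  rw [← aux_prod_root hr hζ (g P) (hg P ((hT P).mp hP).1)]
  apply Finset.prod_congr rfl
  intro i _
  have hC : PowerSeries.rescale (ζ ^ i) (PowerSeries.C (g P)) = PowerSeries.C (g P) := by
    ext m
    rw [PowerSeries.coeff_rescale, PowerSeries.coeff_C]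
    split_ifs with hm
    · simp [hm]
    · simp
  symm
  rw [map_sub, map_one, map_mul, map_pow, PowerSeries.rescale_X, hC, mul_pow,
    map_mul, map_pow PowerSeries.C (ζ ^ i), mul_assoc]

theorem LSer_prod_eq (deg : Ideal A → ℕ)
    (hfin : ∀ n, {I : Ideal A | I ≠ ⊥ ∧ deg I = n}.Finite) (g g' : Ideal A →* ℂ)
    (hmul : ∀ I J : Ideal A, I ≠ ⊥ → J ≠ ⊥ → deg (I * J) = deg I + deg J)
    {r : ℕ} (hr : 0 < r) {ζ : ℂ} (hζ : IsPrimitiveRoot ζ r)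
    (hg : ∀ P, Prime P → g P ^ (r / r.gcd (deg P)) = 1)
    (hg' : ∀ P, Prime P → g' P ^ (r / r.gcd (deg P)) = 1) :
    (∏ i ∈ Finset.range r, PowerSeries.rescale (ζ ^ i) (LSer deg hfin g Set.univ)) =
    (∏ i ∈ Finset.range r, PowerSeries.rescale (ζ ^ i) (LSer deg hfin g' Set.univ)) := by
  ext n
  obtain ⟨T, hT⟩ := exists_primes_finset deg hfin n
  have h1 := LSer_prod_dvd deg hfin g hmul hr hζ hg n T hT
  have h2 := LSer_prod_dvd deg hfin g' hmul hr hζ hg' n T hT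
  set W := ∏ i ∈ Finset.range r, PowerSeries.rescale (ζ ^ i) (LSer deg hfin g Set.univ)
  set W' := ∏ i ∈ Finset.range r, PowerSeries.rescale (ζ ^ i) (LSer deg hfin g' Set.univ)
  set B : PowerSeries ℂ := ∏ P ∈ T, (1 - PowerSeries.X ^ (deg P * (r / r.gcd (deg P)))) ^ (r.gcd (deg P))
  have h3 : (PowerSeries.X : PowerSeries ℂ) ^ (n + 1) ∣ W - W' := by
    have : W - W' = W * -(W' * B - 1) + W' * (W * B - 1) := by ring
    rw [this]
    exact dvd_add ((dvd_neg.mpr h2).mul_left _) (h1.mul_left _)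
  rw [PowerSeries.X_pow_dvd_iff] at h3
  have := h3 n (by omega)
  rwa [map_sub, sub_eq_zero] at this

theorem LSer_prod_nat (deg : Ideal A → ℕ)
    (hfin : ∀ n, {I : Ideal A | I ≠ ⊥ ∧ deg I = n}.Finite) (g : Ideal A →* ℂ)
    (hmul : ∀ I J : Ideal A, I ≠ ⊥ → J ≠ ⊥ → deg (I * J) = deg I + deg J)
    (hpos : ∀ P : Ideal A, Prime P → 0 < deg P)
    {r : ℕ} (hr : 0 < r) {ζ : ℂ} (hζ : IsPrimitiveRoot ζ r)
    (hg : ∀ P, Prime P → g P ^ (r / r.gcd (deg P)) = 1) (n : ℕ) :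
    ∃ w : ℕ, PowerSeries.coeff n
      (∏ i ∈ Finset.range r, PowerSeries.rescale (ζ ^ i) (LSer deg hfin g Set.univ)) = w ∧
      (n = 0 → w = 1) := by
  obtain ⟨T, hT⟩ := exists_primes_finset deg hfin n
  have h1 := LSer_prod_dvd deg hfin g hmul hr hζ hg n T hT
  set W := ∏ i ∈ Finset.range r, PowerSeries.rescale (ζ ^ i) (LSer deg hfin g Set.univ)
  have hex : ∀ e : ℕ, 0 < e → ∃ G : PowerSeries ℕ, PowerSeries.constantCoeff G = 1 ∧
      (1 - PowerSeries.X ^ e) * PowerSeries.map (Nat.castRingHom ℂ) G = 1 := by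
    intro e he
    refine ⟨PowerSeries.mk fun j => if e ∣ j then 1 else 0, by simp, ?_⟩
    ext j
    rw [sub_mul, one_mul, map_sub, mul_comm, PowerSeries.coeff_mul_X_pow']
    simp only [PowerSeries.coeff_map, PowerSeries.coeff_mk, PowerSeries.coeff_one]
    by_cases hej : e ≤ j
    · rw [if_pos hej, if_neg (by omega : ¬ j = 0)]
      have : e ∣ j - e ↔ e ∣ j := by
        rw [Nat.dvd_sub_iff_left hej dvd_rfl]
      simp only [this, sub_self]
    · rw [if_neg hej, sub_zero]
      by_cases hj : j = 0
      · simp [hj]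
      · rw [if_neg hj, if_neg (fun h => hej (Nat.le_of_dvd (by omega) h))]
        simp
  choose! G hG0 hG using hex
  set B : PowerSeries ℂ := ∏ P ∈ T, (1 - PowerSeries.X ^ (deg P * (r / r.gcd (deg P)))) ^ (r.gcd (deg P)) with hB
  set Γ : PowerSeries ℕ := ∏ P ∈ T, (G (deg P * (r / r.gcd (deg P)))) ^ (r.gcd (deg P)) with hΓ
  have hpos' : ∀ P ∈ T, 0 < deg P * (r / r.gcd (deg P)) := by
    intro P hP
    exact Nat.mul_pos (hpos P ((hT P).mp hP).1) (Nat.div_pos (Nat.le_of_dvd hr (Nat.gcd_dvd_left _ _)) (Nat.gcd_pos_of_pos_left _ hr))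
  have hBG : B * PowerSeries.map (Nat.castRingHom ℂ) Γ = 1 := by
    rw [hΓ, map_prod, hB, ← Finset.prod_mul_distrib]
    apply Finset.prod_eq_one
    intro P hP
    rw [map_pow, ← mul_pow, hG _ (hpos' P hP), one_pow]
  have h3 : (PowerSeries.X : PowerSeries ℂ) ^ (n + 1) ∣ W - PowerSeries.map (Nat.castRingHom ℂ) Γ := by
    have : W - PowerSeries.map (Nat.castRingHom ℂ) Γ
        = PowerSeries.map (Nat.castRingHom ℂ) Γ * (W * B - 1) := by
      rw [mul_sub, mul_one, mul_comm W B, ← mul_assoc, mul_comm _ B, hBG, one_mul]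
    rw [this]
    exact h1.mul_left _
  rw [PowerSeries.X_pow_dvd_iff] at h3
  have := h3 n (by omega)
  rw [map_sub, sub_eq_zero] at this
  refine ⟨PowerSeries.coeff n Γ, by rw [this, PowerSeries.coeff_map]; simp, ?_⟩
  rintro rfl
  rw [PowerSeries.coeff_zero_eq_constantCoeff_apply, hΓ, map_prod]
  apply Finset.prod_eq_one
  intro P hP
  rw [map_pow, hG0 _ (hpos' P hP), one_pow]

end PartA


theorem aux_coe_comp (p : ℂ[X]) (a : ℂ) :
    ((p.comp (C a * X) : ℂ[X]) : PowerSeries ℂ) = PowerSeries.rescale a (p : PowerSeries ℂ) := by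
  ext n
  rw [Polynomial.coeff_coe, Polynomial.comp_C_mul_X_coeff, PowerSeries.coeff_rescale,
    Polynomial.coeff_coe, mul_comm]

theorem aux_exists_poly (F : PowerSeries ℂ) (d : ℕ) (h : ∀ n, d ≤ n → PowerSeries.coeff n F = 0) :
    ((PowerSeries.trunc d F : ℂ[X]) : PowerSeries ℂ) = F := by
  ext n
  rw [Polynomial.coeff_coe, PowerSeries.coeff_trunc]
  split_ifs with hn
  · rfl
  · rw [h n (by omega)]

theorem aux_even_sum {r : ℕ} (hr : Odd r) (m : ℕ → ℕ) (h0 : m 0 = 0)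
    (hm : ∀ i, i < r → 0 < i → m (r - i) = m i) : Even (∑ i ∈ Finset.range r, m i) := by
  have h : ∑ i ∈ Finset.range r, (m i : ZMod 2) = 0 := by
    have hsub : ∑ i ∈ Finset.range r, (m i : ZMod 2) = ∑ i ∈ Finset.Ico 1 r, (m i : ZMod 2) := by
      rw [Finset.range_eq_Ico, Finset.sum_eq_sum_Ico_succ_bot hr.pos, h0]
      simp
    rw [hsub]
    apply Finset.sum_involution (fun i _ => r - i)
    · intro i hi
      rw [Finset.mem_Ico] at hi
      rw [hm i (by omega) (by omega)]
      exact CharTwo.add_self_eq_zero _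
    · intro i hi _ h
      rw [Finset.mem_Ico] at hi
      obtain ⟨t, ht⟩ := hr
      omega
    · intro i hi
      rw [Finset.mem_Ico] at *
      omega
    · intro i hi
      rw [Finset.mem_Ico] at hi
      omega
  rw [← Nat.cast_sum] at h
  exact (ZMod.natCast_eq_zero_iff_even).mp h

theorem poly_contra {r : ℕ} (hr : Odd r) {ζ : ℂ} (hζ : IsPrimitiveRoot ζ r) (Q : ℕ) (hQ : 0 < Q)
    (L Z : PowerSeries ℂ)
    (hprod : ∏ i ∈ Finset.range r, PowerSeries.rescale (ζ ^ i) L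
      = ∏ i ∈ Finset.range r, PowerSeries.rescale (ζ ^ i) Z)
    (d : ℕ) (hL : ∀ n, d ≤ n → PowerSeries.coeff n L = 0)
    (hZ : ∀ n, ∃ z : ℕ, PowerSeries.coeff n Z = z)
    (hZ' : ∀ n, d ≤ n → PowerSeries.coeff (n + 1) Z = Q * PowerSeries.coeff n Z ∧
      PowerSeries.coeff n Z ≠ 0)
    (hW : ∀ n, ∃ w : ℕ, PowerSeries.coeff n
      (∏ i ∈ Finset.range r, PowerSeries.rescale (ζ ^ i) L) = w ∧ (n = 0 → w = 1)) : False := by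
  have hQC : (Q : ℂ) ≠ 0 := by exact_mod_cast hQ.ne'
  set α : ℂ := (Q : ℂ)⁻¹ with hα
  have hQα : (Q : ℂ) * α = 1 := mul_inv_cancel₀ hQC
  set Lp : ℂ[X] := PowerSeries.trunc d L with hLp
  have hLp' : (Lp : PowerSeries ℂ) = L := aux_exists_poly L d hL
  set F : PowerSeries ℂ := Z * (1 - PowerSeries.C (Q : ℂ) * PowerSeries.X) with hF
  have hFs : ∀ n, PowerSeries.coeff (n + 1) F
      = PowerSeries.coeff (n + 1) Z - Q * PowerSeries.coeff n Z := by
    intro n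
    rw [hF, mul_sub, mul_one, map_sub, mul_left_comm, PowerSeries.coeff_C_mul,
      PowerSeries.coeff_succ_mul_X]
  have hF0 : PowerSeries.coeff 0 F = PowerSeries.coeff 0 Z := by
    rw [hF]; simp
  set q : ℂ[X] := PowerSeries.trunc (d + 1) F with hq
  have hq' : (q : PowerSeries ℂ) = F := by
    apply aux_exists_poly
    intro n hn
    obtain ⟨n, rfl⟩ : ∃ t, n = t + 1 := ⟨n - 1, by omega⟩
    rw [hFs, (hZ' n (by omega)).1, sub_self]
  -- evaluation of `q` at `α`
  have hqα : q.eval α ≠ 0 := by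
    have htel : ∀ n, ∑ i ∈ Finset.range (n + 1), PowerSeries.coeff i F * α ^ i
        = PowerSeries.coeff n Z * α ^ n := by
      intro n
      induction n with
      | zero => simp [hF0]
      | succ n ih =>
        rw [Finset.sum_range_succ, ih, hFs, pow_succ]
        linear_combination (-PowerSeries.coeff n Z * α ^ n) * hQα
    have : q.eval α = PowerSeries.coeff d Z * α ^ d := by
      rw [← htel, hq, Polynomial.eval, PowerSeries.eval₂_trunc_eq_sum_range]
      simp
    rw [this]
    exact mul_ne_zero (hZ' d le_rfl).2 (pow_ne_zero _ (inv_ne_zero hQC))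
  -- the polynomial identity
  set W : ℂ[X] := ∏ i ∈ Finset.range r, Lp.comp (C (ζ ^ i) * X) with hWdef
  have hWco : (W : PowerSeries ℂ) = ∏ i ∈ Finset.range r, PowerSeries.rescale (ζ ^ i) L := by
    rw [hWdef, ← Polynomial.coeToPowerSeries.ringHom_apply, map_prod]
    apply Finset.prod_congr rfl
    intro i _
    rw [Polynomial.coeToPowerSeries.ringHom_apply, aux_coe_comp, hLp']
  have hid : ∏ i ∈ Finset.range r, q.comp (C (ζ ^ i) * X)
      = W * ∏ i ∈ Finset.range r, (1 - C ((Q : ℂ) * ζ ^ i) * X) := by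
    apply Polynomial.coe_injective
    rw [Polynomial.coe_mul, hWco, hprod, ← Polynomial.coeToPowerSeries.ringHom_apply,
      ← Polynomial.coeToPowerSeries.ringHom_apply, map_prod, map_prod, ← Finset.prod_mul_distrib]
    apply Finset.prod_congr rfl
    intro i _
    rw [Polynomial.coeToPowerSeries.ringHom_apply, aux_coe_comp, hq', hF, map_mul]
    congr 1
    have := aux_coe_comp (1 - C (Q : ℂ) * X) (ζ ^ i)
    simp only [Polynomial.coe_sub, Polynomial.coe_one, Polynomial.coe_mul, Polynomial.coe_C,
      Polynomial.coe_X] at this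
    rw [← this, Polynomial.coeToPowerSeries.ringHom_apply]
    congr 1
    simp [mul_assoc]
  have hWα : W.eval α ≠ 0 := by
    choose w hw using hW
    have hcoef : ∀ n, W.coeff n = w n := by
      intro n
      rw [← (hw n).1, ← hWco, Polynomial.coeff_coe]
    have h1 : W.eval α = ((∑ i ∈ Finset.range (W.natDegree + 1), (w i : ℝ) * ((Q : ℝ)⁻¹) ^ i : ℝ) : ℂ) := by
      rw [Polynomial.eval_eq_sum_range]
      push_cast
      simp only [hcoef, hα]
    rw [h1]
    have h2 : (0 : ℝ) < ∑ i ∈ Finset.range (W.natDegree + 1), (w i : ℝ) * ((Q : ℝ)⁻¹) ^ i := by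
      apply Finset.sum_pos'
      · intro i _; positivity
      · refine ⟨0, by simp, ?_⟩
        rw [(hw 0).2 rfl]; simp
    exact_mod_cast h2.ne'
  have hq0 : q ≠ 0 := by rintro h; simp [h] at hqα
  have hζ0 : ζ ≠ 0 := hζ.ne_zero hr.pos.ne'
  have hne1 : ∀ i ∈ Finset.range r, q.comp (C (ζ ^ i) * X) ≠ 0 := by
    intro i _ h
    have h2 : (q.comp (C (ζ ^ i) * X)).comp (C (ζ ^ i)⁻¹ * X) = q := by
      rw [Polynomial.comp_assoc]
      simp only [mul_comp, C_comp, X_comp]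
      rw [← mul_assoc, ← C_mul, mul_inv_cancel₀ (pow_ne_zero _ hζ0)]
      simp
    rw [h] at h2
    exact hq0 (by simpa using h2.symm)
  have hlin : ∀ i, (1 - C ((Q : ℂ) * ζ ^ i) * X) = C (-((Q : ℂ) * ζ ^ i)) * (X - C (α * (ζ ^ i)⁻¹)) := by
    intro i
    have h : (Q : ℂ) * ζ ^ i * (α * (ζ ^ i)⁻¹) = 1 := by
      rw [hα]; field_simp
    rw [mul_sub, ← C_mul, neg_mul, h]
    simp; ring
  have hne2 : ∀ i ∈ Finset.range r, (1 - C ((Q : ℂ) * ζ ^ i) * X) ≠ 0 := by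
    intro i _ h
    have := congrArg (eval 0) h
    simp at this
  have hL1 : rootMultiplicity α (∏ i ∈ Finset.range r, q.comp (C (ζ ^ i) * X))
      = ∑ i ∈ Finset.range r, rootMultiplicity α (q.comp (C (ζ ^ i) * X)) := by
    rw [← Polynomial.count_roots, Polynomial.roots_prod _ _ (Finset.prod_ne_zero_iff.mpr hne1),
      Multiset.count_bind]
    simp [Finset.sum]
  have hR1 : rootMultiplicity α (W * ∏ i ∈ Finset.range r, (1 - C ((Q : ℂ) * ζ ^ i) * X)) = 1 := by
    have hW0 : W ≠ 0 := by rintro h; simp [h] at hWα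
    have hP0 := (Finset.prod_ne_zero_iff.mpr hne2)
    rw [Polynomial.rootMultiplicity_mul (mul_ne_zero hW0 hP0),
      Polynomial.rootMultiplicity_eq_zero (by simpa using hWα), zero_add]
    rw [← Polynomial.count_roots, Polynomial.roots_prod _ _ hP0, Multiset.count_bind]
    have : ∀ i ∈ Finset.range r, Multiset.count α (1 - C ((Q : ℂ) * ζ ^ i) * X).roots
        = if i = 0 then 1 else 0 := by
      intro i hi
      rw [hlin i, Polynomial.roots_C_mul _ (neg_ne_zero.mpr (mul_ne_zero hQC (pow_ne_zero _ hζ0))),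
        Polynomial.roots_X_sub_C, Multiset.count_singleton]
      congr 1
      rw [eq_iff_iff]
      constructor
      · intro h
        by_contra hi0
        have h1 : (ζ ^ i)⁻¹ = 1 := by
          have hα0 : α ≠ 0 := inv_ne_zero hQC
          exact mul_left_cancel₀ hα0 (by rw [mul_one]; exact h.symm)
        rw [inv_eq_one] at h1
        exact hζ.pow_ne_one_of_pos_of_lt hi0 (Finset.mem_range.mp hi) h1
      · rintro rfl; simp
    change ∑ i ∈ Finset.range r, _ = 1
    rw [Finset.sum_congr rfl this]
    simp [hr.pos]
  have heven := aux_even_sum hr (fun i => rootMultiplicity α (q.comp (C (ζ ^ i) * X)))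
    (by
      apply Polynomial.rootMultiplicity_eq_zero
      simpa using hqα)
    (by
      intro i hi hi0
      have hqr : q.map (starRingEnd ℂ) = q := by
        ext n
        rw [Polynomial.coeff_map, hq, PowerSeries.coeff_trunc]
        split_ifs
        · choose z hz using hZ
          cases n with
          | zero => rw [hF0, hz]; simp
          | succ n => rw [hFs, hz, hz]; simp
        · simp
      have hinj : Function.Injective (starRingEnd ℂ) := (starRingEnd ℂ).injective
      have h1 := Polynomial.eq_rootMultiplicity_map (p := q.comp (C (ζ ^ i) * X)) hinj α
      have hconj : (starRingEnd ℂ) (ζ ^ i) = ζ ^ (r - i) := by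
        have hn : ‖ζ‖ = 1 := hζ.norm'_eq_one hr.pos.ne'
        have h2 : (starRingEnd ℂ) (ζ ^ i) = (ζ ^ i)⁻¹ := by
          rw [Complex.inv_def, Complex.normSq_eq_norm_sq]
          simp [hn]
        rw [h2]
        apply inv_eq_of_mul_eq_one_right
        rw [← pow_add, Nat.add_sub_cancel' hi.le, hζ.pow_eq_one]
      rw [Polynomial.map_comp, hqr, Polynomial.map_mul, Polynomial.map_C, Polynomial.map_X, hconj] at h1
      have hαc : (starRingEnd ℂ) α = α := by simp [hα]
      rw [hαc] at h1
      exact h1.symm)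
  rw [hid, hR1] at hL1
  rw [← hL1] at heven
  exact absurd heven (by decide)

section PartA3

variable {A : Type*} [CommRing A] [IsDedekindDomain A]

open Classical in
noncomputable def idealCls (I : Ideal A) : ClassGroup A :=
  if h : I = ⊥ then 1 else ClassGroup.mk0 ⟨I, mem_nonZeroDivisors_of_ne_zero h⟩

theorem idealCls_of_ne (I : Ideal A) (h : I ≠ ⊥) :
    idealCls I = ClassGroup.mk0 ⟨I, mem_nonZeroDivisors_of_ne_zero h⟩ := by
  rw [idealCls, dif_neg h]

theorem idealCls_mul (I J : Ideal A) (hI : I ≠ ⊥) (hJ : J ≠ ⊥) :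
    idealCls (I * J) = idealCls I * idealCls J := by
  rw [idealCls_of_ne _ hI, idealCls_of_ne _ hJ, idealCls_of_ne _ (mul_ne_zero hI hJ), ← map_mul]
  rfl

theorem idealCls_pow (I : Ideal A) (hI : I ≠ ⊥) (n : ℕ) :
    idealCls (I ^ n) = idealCls I ^ n := by
  rw [idealCls_of_ne _ hI, idealCls_of_ne _ (pow_ne_zero _ hI), ← map_pow]
  rfl

theorem idealCls_one : idealCls (1 : Ideal A) = 1 := by
  have := idealCls_mul (1 : Ideal A) 1 one_ne_zero one_ne_zero
  rw [mul_one] at this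
  exact left_eq_mul.mp this

open Classical in
noncomputable def gChi (χ : ClassGroup A →* ℂˣ) : Ideal A →* ℂ where
  toFun I := if I = ⊥ then 0 else (χ (idealCls I) : ℂ)
  map_one' := by
    have h1 : (1 : Ideal A) ≠ ⊥ := one_ne_zero
    rw [if_neg h1, idealCls_one]
    simp
  map_mul' I J := by
    by_cases hI : I = ⊥
    · simp [hI]
    by_cases hJ : J = ⊥
    · simp [hJ]
    have hIJ : I * J ≠ ⊥ := mul_ne_zero hI hJ
    rw [if_neg hI, if_neg hJ, if_neg hIJ, idealCls_mul I J hI hJ]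
    simp

theorem gChi_apply (χ : ClassGroup A →* ℂˣ) (I : Ideal A) (h : I ≠ ⊥) :
    gChi χ I = (χ (idealCls I) : ℂ) := by
  simp [gChi, h]

theorem partA_final [Finite (ClassGroup A)] (deg : Ideal A → ℕ)
    (hfin : ∀ n, {I : Ideal A | I ≠ ⊥ ∧ deg I = n}.Finite)
    (hmul : ∀ I J : Ideal A, I ≠ ⊥ → J ≠ ⊥ → deg (I * J) = deg I + deg J)
    (hpos : ∀ P : Ideal A, Prime P → 0 < deg P)
    (Q : ℕ) (hQ : 0 < Q) (N : ℕ → ℕ) (d : ℕ)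
    (hN : ∀ n, d ≤ n → 0 < N n ∧ N (n + 1) = Q * N n)
    (hcount : ∀ n, d ≤ n → ∀ c : ClassGroup A,
      {I : Ideal A | I ≠ ⊥ ∧ deg I = n ∧ idealCls I = c}.ncard = N n)
    {r : ℕ} (hr : Odd r) (χ : ClassGroup A →* ℂˣ) (hχ1 : χ ≠ 1)
    (hχ : ∀ P : Ideal A, Prime P → χ (idealCls P) ^ (r / r.gcd (deg P)) = 1) : False := by
  classical
  have := Fintype.ofFinite (ClassGroup A)
  have hζ := Complex.isPrimitiveRoot_exp r hr.pos.ne'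
  have hcoef : ∀ (ψ : ClassGroup A →* ℂˣ) n, PowerSeries.coeff n (LSer deg hfin (gChi ψ) Set.univ)
      = ∑ I ∈ (hfin n).toFinset, (ψ (idealCls I) : ℂ) := by
    intro ψ n
    simp only [LSer, PowerSeries.coeff_mk, Set.mem_univ, implies_true, Finset.filter_true]
    apply Finset.sum_congr rfl
    intro I hI
    simp only [Set.Finite.mem_toFinset, Set.mem_ofPred_eq] at hI
    exact gChi_apply ψ I hI.1
  have hlarge : ∀ (ψ : ClassGroup A →* ℂˣ) n, d ≤ n →
      PowerSeries.coeff n (LSer deg hfin (gChi ψ) Set.univ) = N n * ∑ c, (ψ c : ℂ) := by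
    intro ψ n hn
    rw [hcoef, ← Finset.sum_fiberwise (s := (hfin n).toFinset) (g := idealCls), Finset.mul_sum]
    apply Finset.sum_congr rfl
    intro c _
    rw [Finset.sum_congr rfl (g := fun _ => (ψ c : ℂ)) (by
      intro I hI
      rw [(Finset.mem_filter.mp hI).2])]
    rw [Finset.sum_const, nsmul_eq_mul, ← hcount n hn c]
    congr 2
    rw [← Set.ncard_coe_finset]
    congr 1
    ext I
    simp [and_assoc]
  have hg : ∀ P, Prime P → gChi χ P ^ (r / r.gcd (deg P)) = 1 := by
    intro P hP
    rw [gChi_apply χ P hP.ne_zero, ← Units.val_pow_eq_pow_val, hχ P hP, Units.val_one]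
  have hg' : ∀ P : Ideal A, Prime P → gChi (1 : ClassGroup A →* ℂˣ) P ^ (r / r.gcd (deg P)) = 1 := by
    intro P hP
    rw [gChi_apply _ P hP.ne_zero]
    simp
  refine poly_contra hr hζ Q hQ (LSer deg hfin (gChi χ) Set.univ) (LSer deg hfin (gChi 1) Set.univ)
    (LSer_prod_eq deg hfin _ _ hmul hr.pos hζ hg hg') d ?_ ?_ ?_
    (LSer_prod_nat deg hfin _ hmul hpos hr.pos hζ hg)
  · intro n hn
    rw [hlarge χ n hn]
    have : ∑ c, (χ c : ℂ) = 0 := by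
      have h1 : (Units.coeHom ℂ).comp χ ≠ 1 := by
        intro h
        apply hχ1
        ext c
        exact DFunLike.congr_fun h c
      exact sum_hom_units_eq_zero _ h1
    rw [this, mul_zero]
  · intro n
    refine ⟨(hfin n).toFinset.card, ?_⟩
    rw [hcoef]
    simp
  · intro n hn
    rw [hlarge _ n hn, hlarge _ (n + 1) (by omega), (hN n hn).2]
    constructor
    · push_cast; ring
    · have := (hN n hn).1
      simp [this.ne']

end PartA3

section PartB

variable {A : Type*} [CommRing A] [IsDedekindDomain A]

theorem aux_cardQuot_mul [Infinite A] (I J : Ideal A) :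
    Submodule.cardQuot (I * J) = Submodule.cardQuot I * Submodule.cardQuot J := by
  exact UniqueFactorizationMonoid.multiplicative_of_coprime Submodule.cardQuot I J
      (Submodule.cardQuot_bot _ _)
      (fun {I J} hI => by simp [Ideal.isUnit_iff.mp hI, Ideal.mul_top])
      (fun {I} i hI =>
        have : Ideal.IsPrime I := Ideal.isPrime_of_prime hI
        cardQuot_pow_of_prime hI.ne_zero)
      fun {I J} hIJ => cardQuot_mul_of_coprime <| Ideal.isCoprime_iff_sup_eq.mpr
        (Ideal.isUnit_iff.mp
          (hIJ (Ideal.dvd_iff_le.mpr le_sup_left) (Ideal.dvd_iff_le.mpr le_sup_right)))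

variable {k : Type*} [Field k] [Finite k] [Algebra k A]

theorem aux_card_quot (hfd : ∀ I : Ideal A, I ≠ ⊥ → Module.Finite k (A ⧸ I)) (I : Ideal A)
    (hI : I ≠ ⊥) : Nat.card (A ⧸ I) = Nat.card k ^ Module.finrank k (A ⧸ I) := by
  have := hfd I hI
  exact Module.natCard_eq_pow_finrank

theorem aux_deg_mul [Infinite A] (hfd : ∀ I : Ideal A, I ≠ ⊥ → Module.Finite k (A ⧸ I))
    (I J : Ideal A) (hI : I ≠ ⊥) (hJ : J ≠ ⊥) :
    Module.finrank k (A ⧸ I * J) = Module.finrank k (A ⧸ I) + Module.finrank k (A ⧸ J) := by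
  have h := aux_cardQuot_mul I J
  rw [Submodule.cardQuot_apply, Submodule.cardQuot_apply, Submodule.cardQuot_apply,
    aux_card_quot hfd I hI, aux_card_quot hfd J hJ, aux_card_quot hfd (I * J) (mul_ne_zero hI hJ),
    ← pow_add] at h
  exact Nat.pow_right_injective (Finite.one_lt_card) h

theorem aux_deg_pos (hfd : ∀ I : Ideal A, I ≠ ⊥ → Module.Finite k (A ⧸ I))
    (P : Ideal A) (hP : Prime P) : 0 < Module.finrank k (A ⧸ P) := by
  have := hfd P hP.ne_zero
  have : Nontrivial (A ⧸ P) := Ideal.Quotient.nontrivial_iff.mpr (Ideal.isPrime_of_prime hP).ne_top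
  exact Module.finrank_pos

/-- intersection count when the quotient map is onto -/
theorem aux_inter_card (I : Ideal A) (V : Submodule k A)
    (hsurj : ∀ y : A ⧸ I, ∃ x ∈ V, Ideal.Quotient.mk I x = y) :
    Nat.card V = Nat.card ↥(V ⊓ I.restrictScalars k) * Nat.card (A ⧸ I) := by
  let φ : V →ₗ[k] (A ⧸ I) := (Ideal.Quotient.mkₐ k I).toLinearMap.comp V.subtype
  have hφ : Function.Surjective φ := by
    intro y
    obtain ⟨x, hx, h⟩ := hsurj y
    exact ⟨⟨x, hx⟩, h⟩
  have h1 := Submodule.card_eq_card_quotient_mul_card (LinearMap.ker φ)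
  rw [Nat.card_congr (φ.quotKerEquivOfSurjective hφ).toEquiv] at h1
  have h2 : Nat.card (LinearMap.ker φ) = Nat.card ↥(V ⊓ I.restrictScalars k) := by
    apply Nat.card_congr
    refine ⟨fun x => ⟨x.1.1, x.1.2, ?_⟩, fun x => ⟨⟨x.1, x.2.1⟩, ?_⟩, fun x => rfl, fun x => rfl⟩
    · exact Ideal.Quotient.eq_zero_iff_mem.mp x.2
    · exact Ideal.Quotient.eq_zero_iff_mem.mpr x.2.2
  rw [h2] at h1
  exact h1

variable (k) in
structure FiltData (A : Type*) [CommRing A] [IsDedekindDomain A] [Algebra k A]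
    (V : ℕ → Submodule k A) (D₀ : ℕ) : Prop where
  hfd : ∀ I : Ideal A, I ≠ ⊥ → Module.Finite k (A ⧸ I)
  hV : ∀ (x : A) (D : ℕ), x ≠ 0 → (x ∈ V D ↔ Module.finrank k (A ⧸ Ideal.span {x}) ≤ D)
  hVfin : ∀ D, Finite (V D)
  hVcard : ∀ D, D₀ ≤ D → Nat.card (V (D + 1)) = Nat.card k * Nat.card (V D)

namespace FiltData

variable {V : ℕ → Submodule k A} {D₀ : ℕ}

theorem mono (h : FiltData k A V D₀) : Monotone V := by
  intro D D' hD x hx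
  by_cases hx0 : x = 0
  · rw [hx0]; exact zero_mem _
  · rw [h.hV x _ hx0] at *; omega

theorem card_add (h : FiltData k A V D₀) (D e : ℕ) (hD : D₀ ≤ D) :
    Nat.card (V (D + e)) = Nat.card k ^ e * Nat.card (V D) := by
  induction e with
  | zero => simp
  | succ e ih => rw [← add_assoc, h.hVcard _ (by omega), ih]; ring

theorem surj (h : FiltData k A V D₀) (I : Ideal A) (hI : I ≠ ⊥) :
    ∃ D₁, ∀ D, D₁ ≤ D → ∀ y : A ⧸ I, ∃ x ∈ V D, Ideal.Quotient.mk I x = y := by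
  have := h.hfd I hI
  have : Finite (A ⧸ I) := Module.finite_of_finite k
  have := Fintype.ofFinite (A ⧸ I)
  choose s hs using Ideal.Quotient.mk_surjective (I := I)
  refine ⟨Finset.univ.sup fun y => Module.finrank k (A ⧸ Ideal.span {s y}), fun D hD y =>
    ⟨s y, ?_, hs y⟩⟩
  by_cases hx0 : s y = 0
  · rw [hx0]; exact zero_mem _
  · rw [h.hV _ _ hx0]
    exact (Finset.le_sup (f := fun y => Module.finrank k (A ⧸ Ideal.span {s y})) (Finset.mem_univ y)).trans hD

theorem exists_mem (h : FiltData k A V D₀) (n : ℕ) :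
    ∃ D, ∀ I : Ideal A, I ≠ ⊥ → Module.finrank k (A ⧸ I) = n → ∃ x ∈ V D, x ≠ 0 ∧ x ∈ I := by
  have hc := h.card_add D₀ (n + 1) le_rfl
  refine ⟨D₀ + (n + 1), fun I hI hn => ?_⟩
  have := h.hfd I hI
  have : Finite (A ⧸ I) := Module.finite_of_finite k
  have := h.hVfin (D₀ + (n + 1))
  have := h.hVfin D₀
  have hlt : Nat.card (A ⧸ I) < Nat.card (V (D₀ + (n + 1))) := by
    rw [aux_card_quot h.hfd I hI, hn, hc]
    calc Nat.card k ^ n < Nat.card k ^ (n + 1) := Nat.pow_lt_pow_right (Finite.one_lt_card) (by omega)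
      _ ≤ _ := Nat.le_mul_of_pos_right _ Nat.card_pos
  have hni : ¬ Function.Injective (fun x : V (D₀ + (n + 1)) => Ideal.Quotient.mk I x.1) := by
    intro hinj
    exact absurd (Nat.card_le_card_of_injective _ hinj) (by omega)
  simp only [Function.Injective, not_forall] at hni
  obtain ⟨a, b, hab, hne⟩ := hni
  refine ⟨a.1 - b.1, sub_mem a.2 b.2, ?_, Ideal.Quotient.eq.mp hab⟩
  rw [sub_ne_zero]
  exact fun h => hne (Subtype.ext h)

theorem finite_deg (h : FiltData k A V D₀) (n : ℕ) :
    {I : Ideal A | I ≠ ⊥ ∧ Module.finrank k (A ⧸ I) = n}.Finite := by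
  obtain ⟨D, hD⟩ := h.exists_mem n
  have := h.hVfin D
  have hfin : (⋃ x : {x : V D // x ≠ 0}, {I : Ideal A | I ∣ Ideal.span {(x.1.1 : A)}}).Finite := by
    apply Set.finite_iUnion
    rintro ⟨x, hx⟩
    have hne : Ideal.span {(x.1 : A)} ≠ 0 := by
      rw [Ne, Ideal.zero_eq_bot, Ideal.span_singleton_eq_bot]
      exact fun h => hx (Subtype.ext h)
    have := UniqueFactorizationMonoid.fintypeSubtypeDvd _ hne
    exact Set.finite_coe_iff.mp (@Finite.of_fintype {I : Ideal A // I ∣ Ideal.span {(x.1 : A)}} this)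
  refine hfin.subset ?_
  rintro I ⟨hI, hn⟩
  obtain ⟨x, hx, hx0, hxI⟩ := hD I hI hn
  refine Set.mem_iUnion.mpr ⟨⟨⟨x, hx⟩, fun h => hx0 (congrArg Subtype.val h)⟩, ?_⟩
  exact Ideal.dvd_span_singleton.mpr hxI

theorem finite_units (h : FiltData k A V D₀) : Finite Aˣ := by
  have := h.hVfin 0
  refine Finite.of_injective (fun u : Aˣ => (⟨u.1, ?_⟩ : V 0)) ?_
  · rw [h.hV _ _ u.ne_zero, Ideal.span_singleton_eq_top.mpr u.isUnit]
    have : Subsingleton (A ⧸ (⊤ : Ideal A)) := Ideal.Quotient.subsingleton_iff.mpr rfl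
    exact (Module.finrank_zero_of_subsingleton).le
  · intro u v huv
    exact Units.ext (congrArg Subtype.val huv)

theorem count [Infinite A] (h : FiltData k A V D₀) (c : ClassGroup A) :
    ∃ n₀, ∀ n, n₀ ≤ n →
      {I : Ideal A | I ≠ ⊥ ∧ Module.finrank k (A ⧸ I) = n + 1 ∧ idealCls I = c}.ncard * Nat.card Aˣ
        + Nat.card (V n) = Nat.card (V (n + 1)) := by
  obtain ⟨⟨I₀, hI₀'⟩, hc⟩ := ClassGroup.mk0_surjective c⁻¹
  have hI₀ : I₀ ≠ ⊥ := nonZeroDivisors.ne_zero hI₀'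
  rw [← idealCls_of_ne I₀ hI₀] at hc
  obtain ⟨D₁, hD₁⟩ := h.surj I₀ hI₀
  set e := Module.finrank k (A ⧸ I₀) with he
  have hQ : 0 < Nat.card k := Nat.card_pos
  have hcardI : ∀ n, max D₀ D₁ ≤ n → Nat.card ↥(V (n + e) ⊓ I₀.restrictScalars k) = Nat.card (V n) := by
    intro n hn
    have h1 := aux_inter_card I₀ (V (n + e)) (hD₁ (n + e) (by omega))
    rw [h.card_add n e (by omega), aux_card_quot h.hfd I₀ hI₀, ← he, mul_comm] at h1
    exact (Nat.eq_of_mul_eq_mul_right (pow_pos hQ e) h1).symm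
  refine ⟨max D₀ D₁, fun n hn => ?_⟩
  rw [← hcardI (n + 1) (by omega), ← hcardI n hn]
  set S := {I : Ideal A | I ≠ ⊥ ∧ Module.finrank k (A ⧸ I) = n + 1 ∧ idealCls I = c} with hS
  have hprin : ∀ J : S, ∃ y : A, I₀ * J.1 = Ideal.span {y} := by
    rintro ⟨J, hJ, -, hJc⟩
    have h1 : idealCls (I₀ * J) = 1 := by
      rw [idealCls_mul _ _ hI₀ hJ, hc, hJc, inv_mul_cancel]
    rw [idealCls_of_ne _ (mul_ne_zero hI₀ hJ), ClassGroup.mk0_eq_one_iff] at h1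
    obtain ⟨y, hy⟩ := h1
    exact ⟨y, hy⟩
  choose y hy using hprin
  have hy0 : ∀ J, y J ≠ 0 := by
    intro J h0
    have := hy J
    rw [h0, Ideal.span_singleton_eq_bot.mpr rfl] at this
    exact mul_ne_zero hI₀ J.2.1 this
  have hydeg : ∀ J, Module.finrank k (A ⧸ Ideal.span {y J}) = n + 1 + e := by
    intro J
    rw [← hy J, aux_deg_mul h.hfd _ _ hI₀ J.2.1, J.2.2.1]; omega
  have hspan : ∀ (J : S) (u : Aˣ), Ideal.span {u.1 * y J} = Ideal.span {y J} := fun J u =>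
    Ideal.span_singleton_mul_left_unit u.isUnit _
  have hlarge := hn
  have := h.hVfin (n + 1 + e)
  have := h.hVfin (n + e)
  have hm1 : ∀ p : S × Aˣ, p.2.1 * y p.1 ∈ V (n + 1 + e) ⊓ I₀.restrictScalars k := by
    rintro ⟨J, u⟩
    have hne : u.1 * y J ≠ 0 := mul_ne_zero u.ne_zero (hy0 _)
    refine Submodule.mem_inf.mpr ⟨?_, ?_⟩
    · exact (h.hV _ _ hne).mpr (by rw [hspan, hydeg])
    · rw [Submodule.restrictScalars_mem]
      apply Ideal.mul_mem_left
      have h1 : y J ∈ I₀ * J.1 := by rw [hy]; exact Ideal.mem_span_singleton_self _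
      exact Ideal.mul_le_left h1
  have hm2 : ∀ x : ↥(V (n + e) ⊓ I₀.restrictScalars k), x.1 ∈ V (n + 1 + e) ⊓ I₀.restrictScalars k :=
    fun x => Submodule.mem_inf.mpr ⟨h.mono (by omega) (Submodule.mem_inf.mp x.2).1, (Submodule.mem_inf.mp x.2).2⟩
  let f : (S × Aˣ) ⊕ ↥(V (n + e) ⊓ I₀.restrictScalars k) → ↥(V (n + 1 + e) ⊓ I₀.restrictScalars k) :=
    Sum.elim (fun p => ⟨p.2.1 * y p.1, hm1 p⟩) (fun x => ⟨x.1, hm2 x⟩)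
  have hf : Function.Bijective f := by
    constructor
    · rintro (⟨J, u⟩ | x) (⟨J', u'⟩ | x') hxx
      · have h1 : u.1 * y J = u'.1 * y J' := congrArg Subtype.val hxx
        have h2 : Ideal.span {y J} = Ideal.span {y J'} := by rw [← hspan J u, h1, hspan]
        rw [← hy, ← hy] at h2
        have h3 : J = J' := Subtype.ext (mul_left_cancel₀ hI₀ h2)
        subst h3
        rw [Units.ext (mul_right_cancel₀ (hy0 J) h1)]
      · exfalso
        have h1 : u.1 * y J = x'.1 := congrArg Subtype.val hxx
        have hne : u.1 * y J ≠ 0 := mul_ne_zero u.ne_zero (hy0 _)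
        have h2 : u.1 * y J ∈ V (n + e) := h1 ▸ x'.2.1
        rw [h.hV _ _ hne, hspan, hydeg] at h2
        omega
      · exfalso
        have h1 : x.1 = u'.1 * y J' := congrArg Subtype.val hxx
        have hne : u'.1 * y J' ≠ 0 := mul_ne_zero u'.ne_zero (hy0 _)
        have h2 : u'.1 * y J' ∈ V (n + e) := h1 ▸ x.2.1
        rw [h.hV _ _ hne, hspan, hydeg] at h2
        omega
      · have h1 : x.1 = x'.1 := congrArg (fun z : ↥(V (n + 1 + e) ⊓ I₀.restrictScalars k) => z.1) hxx
        rw [Subtype.ext h1]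
    · rintro ⟨x, hx1, hx2⟩
      by_cases hx : x ∈ V (n + e)
      · exact ⟨Sum.inr ⟨x, hx, hx2⟩, rfl⟩
      · have hx0 : x ≠ 0 := fun h0 => hx (h0 ▸ zero_mem _)
        rw [SetLike.mem_coe, h.hV _ _ hx0] at hx1
        rw [h.hV _ _ hx0] at hx
        have hdx : Module.finrank k (A ⧸ Ideal.span {x}) = n + 1 + e := by omega
        obtain ⟨J, hJ⟩ : I₀ ∣ Ideal.span {x} := Ideal.dvd_span_singleton.mpr hx2
        have hsx : Ideal.span {x} ≠ ⊥ := by rwa [Ne, Ideal.span_singleton_eq_bot]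
        have hJ0 : J ≠ ⊥ := by
          rintro rfl
          rw [Ideal.mul_bot] at hJ
          exact hsx hJ
        have hJS : J ∈ S := by
          refine ⟨hJ0, ?_, ?_⟩
          · rw [hJ, aux_deg_mul h.hfd _ _ hI₀ hJ0] at hdx; omega
          · have h1 : idealCls (Ideal.span {x}) = 1 := by
              rw [idealCls_of_ne _ hsx, ClassGroup.mk0_eq_one_iff]
              exact ⟨⟨x, rfl⟩⟩
            rw [hJ, idealCls_mul _ _ hI₀ hJ0, hc] at h1
            exact (inv_mul_eq_one.mp h1).symm
        have h2 : Ideal.span {y ⟨J, hJS⟩} = Ideal.span {x} := by rw [← hy, hJ]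
        obtain ⟨u, hu⟩ := Ideal.span_singleton_eq_span_singleton.mp h2
        refine ⟨Sum.inl (⟨J, hJS⟩, u), Subtype.ext ?_⟩
        change u.1 * y _ = x
        rw [mul_comm]; exact hu
  have hSfin : S.Finite := (h.finite_deg (n + 1)).subset (fun I hI => ⟨hI.1, hI.2.1⟩)
  have : Finite S := hSfin
  have := h.finite_units
  have : Finite ↥(V (n + e) ⊓ I₀.restrictScalars k) :=
    Finite.of_injective (fun x => (⟨x.1, x.2.1⟩ : V (n + e))) (fun a b hab => by
      exact Subtype.ext (congrArg (fun z : V (n + e) => z.1) hab))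
  have h1 := Nat.card_congr (Equiv.ofBijective f hf)
  rw [Nat.card_sum, Nat.card_prod, Nat.card_coe_set_eq] at h1
  exact h1

theorem final [Infinite A] [Finite (ClassGroup A)] (h : FiltData k A V D₀)
    {r : ℕ} (hr : Odd r) (χ : ClassGroup A →* ℂˣ) (hχ1 : χ ≠ 1)
    (hχ : ∀ P : Ideal A, Prime P →
      χ (idealCls P) ^ (r / r.gcd (Module.finrank k (A ⧸ P))) = 1) : False := by
  have := Fintype.ofFinite (ClassGroup A)
  choose n₀ hn₀ using h.count
  have hu : 0 < Nat.card Aˣ := by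
    have := h.finite_units
    exact Nat.card_pos
  set M := max D₀ (Finset.univ.sup n₀) with hM
  have hle : ∀ c, n₀ c ≤ M := fun c => (Finset.le_sup (Finset.mem_univ c)).trans (le_max_right _ _)
  have hQ : 1 < Nat.card k := Finite.one_lt_card
  set cnt : ClassGroup A → ℕ → ℕ := fun c n =>
    {I : Ideal A | I ≠ ⊥ ∧ Module.finrank k (A ⧸ I) = n ∧ idealCls I = c}.ncard with hcnt
  have key : ∀ c n, M ≤ n → cnt c (n + 1) * Nat.card Aˣ + Nat.card (V n) = Nat.card (V (n + 1)) :=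
    fun c n hn => hn₀ c n ((hle c).trans hn)
  refine partA_final (fun I => Module.finrank k (A ⧸ I)) h.finite_deg (aux_deg_mul h.hfd)
    (aux_deg_pos h.hfd) (Nat.card k) (by omega) (cnt 1) (M + 1) ?_ ?_ hr χ hχ1 hχ
  · intro n hn
    obtain ⟨n, rfl⟩ : ∃ t, n = t + 1 := ⟨n - 1, by omega⟩
    have h1 := key 1 n (by omega)
    have h2 := key 1 (n + 1) (by omega)
    have h3 := h.hVcard n (by omega)
    have h4 := h.hVcard (n + 1) (by omega)
    have := h.hVfin n
    have hpos : 0 < Nat.card (V n) := Nat.card_pos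
    constructor
    · by_contra h0
      have h0' : cnt 1 (n + 1) = 0 := by omega
      rw [h0', zero_mul, zero_add, h3] at h1
      nlinarith
    · apply Nat.eq_of_mul_eq_mul_right hu
      nlinarith
  · intro n hn c
    obtain ⟨n, rfl⟩ : ∃ t, n = t + 1 := ⟨n - 1, by omega⟩
    have h1 := key 1 n (by omega)
    have h2 := key c n (by omega)
    apply Nat.eq_of_mul_eq_mul_right hu
    change cnt c (n + 1) * _ = _
    omega

end FiltData

end PartB

section PartC

variable {k : Type*} [Field k]

theorem aux_deg_norm (F a b : k[X]) (hF : Odd F.natDegree) (D : ℕ) (hab : a ≠ 0 ∨ b ≠ 0) :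
    (a ^ 2 - F * b ^ 2).natDegree ≤ D ↔
      (a ∈ degreeLT k ((D + 2) / 2) ∧ b ∈ degreeLT k ((D + 2 - F.natDegree) / 2)) := by
  have hF0 : F ≠ 0 := by rintro rfl; simp at hF
  obtain ⟨t, ht⟩ := hF
  have key : ∀ (c : k[X]) (e : ℕ), c ≠ 0 → (c ∈ degreeLT k e ↔ c.natDegree < e) := by
    intro c e hc
    rw [mem_degreeLT, degree_eq_natDegree hc]; norm_cast
  by_cases ha : a = 0
  · have hb : b ≠ 0 := by tauto
    subst ha
    have h1 : ((0 : k[X]) ^ 2 - F * b ^ 2).natDegree = F.natDegree + 2 * b.natDegree := by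
      rw [zero_pow two_ne_zero, zero_sub, natDegree_neg, natDegree_mul hF0 (pow_ne_zero _ hb), natDegree_pow]
    rw [h1, key b _ hb]
    simp only [zero_mem, true_and]
    omega
  by_cases hb : b = 0
  · subst hb
    have h1 : (a ^ 2 - F * 0 ^ 2).natDegree = 2 * a.natDegree := by
      rw [zero_pow two_ne_zero, mul_zero, sub_zero, natDegree_pow]
    rw [h1, key a _ ha]
    simp only [zero_mem, and_true]
    omega
  have h1 : (F * b ^ 2).natDegree = F.natDegree + 2 * b.natDegree := by
    rw [natDegree_mul hF0 (pow_ne_zero _ hb), natDegree_pow]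
  have h2 : (a ^ 2).natDegree = 2 * a.natDegree := natDegree_pow _ _
  rw [key a _ ha, key b _ hb]
  rcases lt_or_gt_of_ne (show 2 * a.natDegree ≠ F.natDegree + 2 * b.natDegree by omega) with h | h
  · rw [natDegree_sub_eq_right_of_natDegree_lt (by omega), h1]; omega
  · rw [natDegree_sub_eq_left_of_natDegree_lt (by omega), h2]; omega

variable {S : Type*} [CommRing S] [IsDedekindDomain S] [Algebra k[X] S] [Algebra k S]
  [IsScalarTower k k[X] S]

/-- the filtration by degree -/
noncomputable def filtV (bs : Module.Basis (Fin 2) k[X] S) (d D : ℕ) : Submodule k S :=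
  (degreeLT k ((D + 2) / 2)).comap (((bs.coord 0).restrictScalars k)) ⊓
  (degreeLT k ((D + 2 - d) / 2)).comap (((bs.coord 1).restrictScalars k))

theorem mem_filtV (bs : Module.Basis (Fin 2) k[X] S) (d D : ℕ) (x : S) :
    x ∈ filtV bs d D ↔ bs.repr x 0 ∈ degreeLT k ((D + 2) / 2) ∧
      bs.repr x 1 ∈ degreeLT k ((D + 2 - d) / 2) := Iff.rfl

theorem filtV_equiv (bs : Module.Basis (Fin 2) k[X] S) (d D : ℕ) :
    Nonempty (filtV bs d D ≃ (Fin ((D + 2) / 2) → k) × (Fin ((D + 2 - d) / 2) → k)) := by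
  refine ⟨Equiv.trans ?_ (Equiv.prodCongr (degreeLTEquiv k _).toEquiv (degreeLTEquiv k _).toEquiv)⟩
  refine ⟨fun x => (⟨bs.repr x.1 0, x.2.1⟩, ⟨bs.repr x.1 1, x.2.2⟩),
    fun y => ⟨bs.equivFun.symm ![y.1.1, y.2.1], ?_⟩, ?_, ?_⟩
  · rw [mem_filtV, ← bs.equivFun_apply, LinearEquiv.apply_symm_apply]
    exact ⟨y.1.2, y.2.2⟩
  · intro x
    apply Subtype.ext
    change bs.equivFun.symm ![bs.repr x.1 0, bs.repr x.1 1] = x.1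
    rw [LinearEquiv.symm_apply_eq]
    ext i : 1
    fin_cases i <;> rfl
  · intro y
    have h : bs.repr (bs.equivFun.symm ![y.1.1, y.2.1]) = bs.repr (bs.equivFun.symm ![y.1.1, y.2.1]) := rfl
    apply Prod.ext <;> apply Subtype.ext
    · change bs.repr (bs.equivFun.symm ![y.1.1, y.2.1]) 0 = y.1.1
      rw [← bs.equivFun_apply, LinearEquiv.apply_symm_apply]; rfl
    · change bs.repr (bs.equivFun.symm ![y.1.1, y.2.1]) 1 = y.2.1
      rw [← bs.equivFun_apply, LinearEquiv.apply_symm_apply]; rfl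

theorem aux_norm (bs : Module.Basis (Fin 2) k[X] S) (F : k[X]) (h0 : bs 0 = 1)
    (h1 : bs 1 * bs 1 = algebraMap k[X] S F) (x : S) :
    Algebra.norm k[X] x = (bs.repr x 0) ^ 2 - F * (bs.repr x 1) ^ 2 := by
  set a := bs.repr x 0 with ha
  set b := bs.repr x 1 with hb
  have hx : x = a • bs 0 + b • bs 1 := by
    conv_lhs => rw [← bs.sum_repr x]
    rw [Fin.sum_univ_two]
  have e0 : x * bs 0 = a • bs 0 + b • bs 1 := by rw [h0, mul_one, ← h0]; exact hx
  have e1 : x * bs 1 = (F * b) • bs 0 + a • bs 1 := by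
    rw [hx, add_mul, smul_mul_assoc, smul_mul_assoc, h1, h0, one_mul]
    simp only [Algebra.smul_def, map_mul]
    ring
  rw [Algebra.norm_eq_matrix_det bs, Matrix.det_fin_two]
  simp only [Algebra.leftMulMatrix_eq_repr_mul, e0, e1, map_add, map_smul, Module.Basis.repr_self]
  simp
  ring

theorem aux_hfd (bs : Module.Basis (Fin 2) k[X] S) (I : Ideal S) (hI : I ≠ ⊥) :
    Module.Finite k (S ⧸ I) := by
  have e := Ideal.quotientEquivDirectSum k bs hI
  exact Module.Finite.equiv e.symm

theorem filtData [Finite k] (bs : Module.Basis (Fin 2) k[X] S) (F : k[X]) (hF : Odd F.natDegree)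
    (h0 : bs 0 = 1) (h1 : bs 1 * bs 1 = algebraMap k[X] S F) :
    FiltData k S (filtV bs F.natDegree) F.natDegree where
  hfd := aux_hfd bs
  hV := by
    intro x D hx
    rw [finrank_quotient_span_eq_natDegree_norm bs hx, aux_norm bs F h0 h1, aux_deg_norm F _ _ hF,
      mem_filtV]
    by_contra hcon
    push Not at hcon
    apply hx
    rw [← bs.sum_repr x, Fin.sum_univ_two, hcon.1, hcon.2]
    simp
  hVfin := by
    intro D
    exact Finite.of_equiv _ (filtV_equiv bs F.natDegree D).some.symm
  hVcard := by
    intro D hD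
    rw [Nat.card_congr (filtV_equiv bs F.natDegree D).some,
      Nat.card_congr (filtV_equiv bs F.natDegree (D + 1)).some]
    simp only [Nat.card_prod, Nat.card_fun, Nat.card_fin]
    rw [← pow_add, ← pow_add, ← pow_succ']
    congr 1
    obtain ⟨t, ht⟩ := hF
    omega

theorem aux_infinite (bs : Module.Basis (Fin 2) k[X] S) : Infinite S := by
  have : Infinite k[X] := inferInstance
  exact Infinite.of_injective _ bs.repr.symm.injective

theorem aux_finite_class [Finite k] (bs : Module.Basis (Fin 2) k[X] S) : Finite (ClassGroup S) := by
  classical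
  have := Fintype.ofFinite k
  have : Module.Finite k[X] S := Module.Finite.of_basis bs
  have := ClassGroup.fintypeOfAdmissibleOfAlgebraic bs
    (Polynomial.cardPowDegreeIsAdmissible : AbsoluteValue.IsAdmissible
      (Polynomial.cardPowDegree : AbsoluteValue k[X] ℤ))
  exact Finite.of_fintype _

theorem exists_basis_adjoinRoot (F : k[X]) :
    ∃ bs : Module.Basis (Fin 2) k[X] (AdjoinRoot (X ^ 2 - C F : k[X][X])),
      bs 0 = 1 ∧ bs 1 * bs 1 = algebraMap k[X] _ F ∧ bs 1 = AdjoinRoot.root _ := by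
  have hm : (X ^ 2 - C F : k[X][X]).Monic := monic_X_pow_sub_C F two_ne_zero
  have hd : (AdjoinRoot.powerBasis' hm).dim = 2 := by
    rw [AdjoinRoot.powerBasis'_dim]; exact natDegree_X_pow_sub_C
  have h1 : AdjoinRoot.root (X ^ 2 - C F : k[X][X]) ^ 2 = algebraMap k[X] _ F := by
    have h := AdjoinRoot.eval₂_root (X ^ 2 - C F : k[X][X])
    rw [eval₂_sub, eval₂_pow, eval₂_X, eval₂_C, sub_eq_zero] at h
    exact h
  refine ⟨(AdjoinRoot.powerBasis' hm).basis.reindex (finCongr hd), ?_, ?_, ?_⟩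
  · rw [Module.Basis.reindex_apply, PowerBasis.basis_eq_pow]; simp
  · rw [Module.Basis.reindex_apply, PowerBasis.basis_eq_pow]
    rw [AdjoinRoot.powerBasis'_gen, ← h1]; simp [sq]
  · rw [Module.Basis.reindex_apply, PowerBasis.basis_eq_pow]
    rw [AdjoinRoot.powerBasis'_gen]; simp

end PartC

section PartD

attribute [local instance] FractionRing.liftAlgebra

variable {R S κ : Type*} [CommRing R] [IsDedekindDomain R] [CommRing S] [IsDedekindDomain S]
  [Algebra R S] [Module.Finite R S] [Module.IsTorsionFree R S] [Field κ] [Fintype κ]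

theorem aux_isGalois (ι : κ →+* S) (hgen : Algebra.adjoin R (Set.range ι) = ⊤) :
    IsGalois (FractionRing R) (FractionRing S) := by
  set K := FractionRing R
  set L := FractionRing S
  set N := Fintype.card κ with hN
  let j : κ →+* L := (algebraMap S L).comp ι
  obtain ⟨p, hp⟩ := CharP.exists κ
  have hpS : CharP L p := charP_of_injective_ringHom j.injective p
  have hpK : CharP K p := (RingHom.charP_iff (algebraMap K L) (algebraMap K L).injective p).mpr hpS
  have hpN : p ∣ N := by
    rw [← CharP.cast_eq_zero_iff κ p]
    exact FiniteField.cast_card_eq_zero κ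
  have hsep : (X ^ N - X : K[X]).Separable := galois_poly_separable p N hpN
  have hmap : ((X ^ N - X : κ[X]).map j) = (X ^ N - X : K[X]).map (algebraMap K L) := by
    simp
  have hspl : (X ^ N - X : κ[X]).Splits := by
    have h := (FiniteField.isSplittingField_sub κ κ).splits'
    simpa using h
  have hne : (X ^ N - X : K[X]) ≠ 0 := FiniteField.X_pow_card_sub_X_ne_zero K Fintype.one_lt_card
  have : (X ^ N - X : K[X]).IsSplittingField K L := by
    rw [isSplittingField_iff_intermediateField]
    constructor
    · rw [← hmap]; exact hspl.map j
    · rw [eq_top_iff]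
      set E := IntermediateField.adjoin K ((X ^ N - X : K[X]).rootSet L) with hE
      have hS : ∀ s : S, algebraMap S L s ∈ E := by
        intro s
        have hs : s ∈ Algebra.adjoin R (Set.range ι) := by rw [hgen]; trivial
        induction hs using Algebra.adjoin_induction with
        | mem x hx =>
          obtain ⟨c, rfl⟩ := hx
          apply IntermediateField.subset_adjoin
          rw [mem_rootSet]
          refine ⟨hne, ?_⟩
          have : ι c ^ N = ι c := by rw [← map_pow, FiniteField.pow_card]
          rw [map_sub, map_pow, aeval_X, ← map_pow, this, sub_self]
        | algebraMap r =>
          rw [← IsScalarTower.algebraMap_apply R S L, IsScalarTower.algebraMap_apply R K L]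
          exact E.algebraMap_mem _
        | add x y _ _ hx hy => rw [map_add]; exact add_mem hx hy
        | mul x y _ _ hx hy => rw [map_mul]; exact mul_mem hx hy
      intro x _
      obtain ⟨a, b, hb, rfl⟩ := IsFractionRing.div_surjective (A := S) x
      exact div_mem (hS a) (hS b)
  exact IsGalois.of_separable_splitting_field hsep

variable {k : Type*} [Field k] [Finite k] [Algebra k R]

theorem aux_inertia (ι : κ →+* S) (hgen : Algebra.adjoin R (Set.range ι) = ⊤) {r : ℕ} (hr : 0 < r)
    (hcard : Fintype.card κ = Nat.card k ^ r) (P : Ideal R) [P.IsMaximal]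
    (hfin : Module.Finite k (R ⧸ P))
    (P' : Ideal S) [P'.IsMaximal] [P'.LiesOver P] :
    P'.inertiaDeg R ∣ r / r.gcd (Module.finrank k (R ⧸ P)) := by
  rw [Ideal.inertiaDeg_eq_of_isMaximal P]
  set d := Module.finrank k (R ⧸ P) with hd
  set g := r / r.gcd d with hg
  let _ := Ideal.Quotient.field P
  let _ := Ideal.Quotient.field P'
  have : Finite (R ⧸ P) := Module.finite_of_finite k
  have := Fintype.ofFinite (R ⧸ P)
  have : Module.Finite (R ⧸ P) (S ⧸ P') := inferInstance
  have : Finite (S ⧸ P') := Module.finite_of_finite (R ⧸ P)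
  rw [← FiniteField.orderOf_frobeniusAlgHom, orderOf_dvd_iff_pow_eq_one]
  have hc : Fintype.card (R ⧸ P) = Nat.card k ^ d := by
    rw [← Nat.card_eq_fintype_card]; exact Module.natCard_eq_pow_finrank
  obtain ⟨t, ht⟩ : r ∣ d * g := by
    refine ⟨d / r.gcd d, ?_⟩
    rw [hg, ← Nat.mul_div_assoc _ (Nat.gcd_dvd_left _ _), ← Nat.mul_div_assoc _ (Nat.gcd_dvd_right _ _), mul_comm]
  have h1 : (((FiniteField.frobeniusAlgHom (R ⧸ P) (S ⧸ P') ^ g).restrictScalars R).comp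
      (Ideal.Quotient.mkₐ R P')) = Ideal.Quotient.mkₐ R P' := by
    apply AlgHom.ext_of_adjoin_eq_top hgen
    rintro _ ⟨c, rfl⟩
    simp only [AlgHom.comp_apply, AlgHom.restrictScalars_apply, AlgHom.coe_pow,
      FiniteField.coe_frobeniusAlgHom, pow_iterate]
    rw [← map_pow, hc, ← pow_mul, ht, pow_mul, ← hcard, ← map_pow, FiniteField.pow_card_pow]
  ext x
  obtain ⟨s, rfl⟩ := Ideal.Quotient.mk_surjective x
  exact DFunLike.congr_fun h1 s

theorem aux_relNorm (ι : κ →+* S) (hgen : Algebra.adjoin R (Set.range ι) = ⊤) {r : ℕ} (hr : 0 < r)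
    (hcard : Fintype.card κ = Nat.card k ^ r)
    (hfd : ∀ I : Ideal R, I ≠ ⊥ → Module.Finite k (R ⧸ I)) (P : Ideal R) (hP : Prime P) :
    ∃ J : Ideal S, J ≠ ⊥ ∧
      Ideal.relNorm R J = P ^ (r / r.gcd (Module.finrank k (R ⧸ P))) := by
  have hPp : P.IsPrime := Ideal.isPrime_of_prime hP
  have hPm : P.IsMaximal := hPp.isMaximal hP.ne_zero
  obtain ⟨P', hm, hl⟩ := Ideal.exists_maximal_ideal_liesOver_of_isIntegral (S := S) P
  have := aux_isGalois ι hgen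
  have h1 := Ideal.relNorm_eq_pow_of_isPrime_isGalois P' P
  obtain ⟨t, ht⟩ := aux_inertia ι hgen hr hcard P (hfd P hP.ne_zero) P'
  refine ⟨P' ^ t, pow_ne_zero _ ?_, ?_⟩
  · exact Ideal.ne_bot_of_liesOver_of_ne_bot hP.ne_zero P'
  · rw [map_pow, h1, ht, pow_mul]

end PartD

section PartE

variable {R S κ k : Type*} [CommRing R] [IsDedekindDomain R] [CommRing S] [IsDedekindDomain S]
  [Algebra R S] [Module.Finite R S] [Module.IsTorsionFree R S] [Field κ] [Fintype κ]
  [Field k] [Finite k] [Algebra k R]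

theorem aux_relNorm_ne_bot (J : Ideal S) (hJ : J ≠ ⊥) : Ideal.relNorm R J ≠ ⊥ := by
  rw [Ne, Ideal.relNorm_eq_bot_iff]; exact hJ

theorem exists_norm_class [Infinite R] [Finite (ClassGroup R)] {V : ℕ → Submodule k R} {D₀ : ℕ}
    (h : FiltData k R V D₀) (ι : κ →+* S) (hgen : Algebra.adjoin R (Set.range ι) = ⊤) {r : ℕ}
    (hr : Odd r) (hcard : Fintype.card κ = Nat.card k ^ r) (c : ClassGroup R) :
    ∃ J : Ideal S, J ≠ ⊥ ∧ idealCls (Ideal.relNorm R J) = c := by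
  let M : Submonoid (ClassGroup R) :=
    { carrier := {c | ∃ J : Ideal S, J ≠ ⊥ ∧ idealCls (Ideal.relNorm R J) = c}
      one_mem' := ⟨1, one_ne_zero, by rw [map_one, idealCls_one]⟩
      mul_mem' := by
        rintro _ _ ⟨J, hJ, rfl⟩ ⟨J', hJ', rfl⟩
        exact ⟨J * J', mul_ne_zero hJ hJ', by
          rw [map_mul, idealCls_mul _ _ (aux_relNorm_ne_bot J hJ) (aux_relNorm_ne_bot J' hJ')]⟩ }
  let H : Subgroup (ClassGroup R) :=
    { M with
      inv_mem' := by
        intro x hx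
        have h1 : x⁻¹ = x ^ (orderOf x - 1) := by
          rw [inv_eq_iff_mul_eq_one, ← pow_succ', Nat.sub_add_cancel (orderOf_pos x), pow_orderOf_eq_one]
        change x⁻¹ ∈ M
        rw [h1]
        exact M.pow_mem hx _ }
  by_contra hcon
  have hcH : c ∉ H := hcon
  have hq : (QuotientGroup.mk c : ClassGroup R ⧸ H) ≠ 1 := by
    rw [Ne, QuotientGroup.eq_one_iff]; exact hcH
  obtain ⟨ψ, hψ⟩ := CommGroup.exists_apply_ne_one_of_hasEnoughRootsOfUnity (ClassGroup R ⧸ H) ℂ hq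
  let χ : ClassGroup R →* ℂˣ := ψ.comp (QuotientGroup.mk' H)
  refine h.final hr χ ?_ ?_
  · intro h1
    exact hψ (DFunLike.congr_fun h1 c)
  · intro P hP
    obtain ⟨J, hJ, hJP⟩ := aux_relNorm ι hgen hr.pos hcard h.hfd P hP
    rw [← map_pow, ← idealCls_pow _ hP.ne_zero, ← hJP]
    have : idealCls (Ideal.relNorm R J) ∈ H := ⟨J, hJ, rfl⟩
    change ψ (QuotientGroup.mk _) = 1
    rw [(QuotientGroup.eq_one_iff _).mpr this, map_one]

theorem idealCls_eq_one_iff {A : Type*} [CommRing A] [IsDedekindDomain A] (I : Ideal A) (hI : I ≠ ⊥) :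
    idealCls I = 1 ↔ I.IsPrincipal := by
  rw [idealCls_of_ne I hI, ClassGroup.mk0_eq_one_iff]

theorem final_abstract [Infinite R] [Finite (ClassGroup R)] [Finite (ClassGroup S)]
    {V : ℕ → Submodule k R} {D₀ : ℕ}
    (h : FiltData k R V D₀) (ι : κ →+* S) (hgen : Algebra.adjoin R (Set.range ι) = ⊤) {r : ℕ}
    (hr : Odd r) (hcard : Fintype.card κ = Nat.card k ^ r) {p : ℕ} (hp : p.Prime)
    (I : Ideal R) (hI : I ≠ ⊥) (hIp : ∃ t : ℕ, (I ^ p ^ t).IsPrincipal) :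
    ∃ J : Ideal S, J ≠ ⊥ ∧ (∃ t : ℕ, (J ^ p ^ t).IsPrincipal) ∧
      ∃ a b : R, a ≠ 0 ∧ b ≠ 0 ∧
        Ideal.span {a} * Ideal.relNorm R J = Ideal.span {b} * I := by
  obtain ⟨J₀, hJ₀, hc⟩ := exists_norm_class h ι hgen hr hcard (idealCls I)
  obtain ⟨t, ht⟩ := hIp
  obtain ⟨a, b, hb, hab⟩ := Nat.exists_eq_pow_mul_and_not_dvd (orderOf_pos (idealCls J₀)).ne' p hp.ne_one
  have hcop : Nat.Coprime (p ^ t) b := Nat.Coprime.pow_left _ ((Nat.Prime.coprime_iff_not_dvd hp).mpr hb)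
  obtain ⟨e, he1, he2⟩ := Nat.chineseRemainder hcop 1 0
  have hJe : J₀ ^ e ≠ ⊥ := pow_ne_zero _ hJ₀
  have hbe : b ∣ e := (Nat.modEq_zero_iff_dvd).mp he2
  refine ⟨J₀ ^ e, hJe, ⟨a, ?_⟩, ?_⟩
  · rw [← idealCls_eq_one_iff _ (pow_ne_zero _ hJe), ← pow_mul, idealCls_pow _ hJ₀,
      ← orderOf_dvd_iff_pow_eq_one, hab, mul_comm]
    exact Nat.mul_dvd_mul_right hbe _
  · have h1 : idealCls (Ideal.relNorm R (J₀ ^ e)) = idealCls I := by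
      rw [map_pow, idealCls_pow _ (aux_relNorm_ne_bot J₀ hJ₀), hc]
      have h2 : idealCls I ^ p ^ t = 1 := by
        rw [← idealCls_pow _ hI, idealCls_eq_one_iff _ (pow_ne_zero _ hI)]; exact ht
      have h3 : e ≡ 1 [MOD orderOf (idealCls I)] := he1.of_dvd (orderOf_dvd_of_pow_eq_one h2)
      rw [pow_eq_pow_iff_modEq.mpr h3, pow_one]
    rw [idealCls_of_ne _ (aux_relNorm_ne_bot _ hJe), idealCls_of_ne _ hI, ClassGroup.mk0_eq_mk0_iff] at h1
    obtain ⟨x, y, hx, hy, hxy⟩ := h1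
    exact ⟨x, y, hx, hy, hxy⟩

end PartE

/-- Let `p` be an odd prime, `q` an odd prime power, and `f ∈ 𝔽_q[T]` squarefree of
odd degree.  Let `k, k'` be the fields with `q^(p^n)` resp. `q^(p^m)` elements
(`n ≤ m`), `R = k[T][x]/(x²-f)`, `R' = k'[T][x]/(x²-f)`, where `R'` is an
`R`-algebra via the natural inclusion.  Then the norm map is surjective on
`p`-primary parts of class groups: for every nonzero ideal `I` of `R` whose
class has `p`-power order, there is a nonzero ideal `J` of `R'` whose class has
`p`-power order such that `N_{R'/R}(J)` lies in the class of `I`, i.e.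
`a·N_{R'/R}(J) = b·I` for some nonzero `a, b ∈ R`. -/
theorem relNorm_surjective_on_p_primary_classes
    {p : ℕ} (hp : p.Prime) (hpodd : Odd p)
    {q : ℕ} (hq : IsPrimePow q) (hqodd : Odd q)
    {n m : ℕ} (hnm : n ≤ m)
    {k₀ k k' : Type*} [Field k₀] [Field k] [Field k'] [Fintype k₀] [Fintype k] [Fintype k']
    [Algebra k₀ k] [Algebra k k'] [Algebra k₀ k'] [IsScalarTower k₀ k k']
    (hk₀ : Fintype.card k₀ = q)
    (hk : Fintype.card k = q ^ p ^ n) (hk' : Fintype.card k' = q ^ p ^ m)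
    (f₀ : k₀[X]) (hf : Squarefree f₀) (hdeg : Odd f₀.natDegree)
    [IsDedekindDomain (AdjoinRoot (X ^ 2 - C (f₀.map (algebraMap k₀ k)) : (k[X])[X]))]
    [IsDedekindDomain (AdjoinRoot (X ^ 2 - C (f₀.map (algebraMap k₀ k')) : (k'[X])[X]))]
    [Algebra (AdjoinRoot (X ^ 2 - C (f₀.map (algebraMap k₀ k)) : (k[X])[X]))
        (AdjoinRoot (X ^ 2 - C (f₀.map (algebraMap k₀ k')) : (k'[X])[X]))]
    (halg₁ : ∀ a : k[X],
      algebraMap (AdjoinRoot (X ^ 2 - C (f₀.map (algebraMap k₀ k)) : (k[X])[X]))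
          (AdjoinRoot (X ^ 2 - C (f₀.map (algebraMap k₀ k')) : (k'[X])[X]))
          (AdjoinRoot.of _ a)
        = AdjoinRoot.of _ (a.map (algebraMap k k')))
    (halg₂ : algebraMap (AdjoinRoot (X ^ 2 - C (f₀.map (algebraMap k₀ k)) : (k[X])[X]))
          (AdjoinRoot (X ^ 2 - C (f₀.map (algebraMap k₀ k')) : (k'[X])[X]))
          (AdjoinRoot.root _)
        = AdjoinRoot.root _)
    [Module.Finite (AdjoinRoot (X ^ 2 - C (f₀.map (algebraMap k₀ k)) : (k[X])[X]))
        (AdjoinRoot (X ^ 2 - C (f₀.map (algebraMap k₀ k')) : (k'[X])[X]))]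
    [Module.Free (AdjoinRoot (X ^ 2 - C (f₀.map (algebraMap k₀ k)) : (k[X])[X]))
        (AdjoinRoot (X ^ 2 - C (f₀.map (algebraMap k₀ k')) : (k'[X])[X]))]
    (I : Ideal (AdjoinRoot (X ^ 2 - C (f₀.map (algebraMap k₀ k)) : (k[X])[X])))
    (hI : I ≠ ⊥) (hIp : ∃ t : ℕ, (I ^ p ^ t).IsPrincipal) :
    ∃ J : Ideal (AdjoinRoot (X ^ 2 - C (f₀.map (algebraMap k₀ k')) : (k'[X])[X])),
      J ≠ ⊥ ∧ (∃ t : ℕ, (J ^ p ^ t).IsPrincipal) ∧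
      ∃ a b : AdjoinRoot (X ^ 2 - C (f₀.map (algebraMap k₀ k)) : (k[X])[X]),
        a ≠ 0 ∧ b ≠ 0 ∧
        Ideal.span {a} *
            Ideal.relNorm (AdjoinRoot (X ^ 2 - C (f₀.map (algebraMap k₀ k)) : (k[X])[X])) J
          = Ideal.span {b} * I := by
  obtain ⟨bs, hbs0, hbs1, -⟩ := exists_basis_adjoinRoot (f₀.map (algebraMap k₀ k))
  obtain ⟨bs', -, -, -⟩ := exists_basis_adjoinRoot (f₀.map (algebraMap k₀ k'))
  have hF : Odd (f₀.map (algebraMap k₀ k)).natDegree := by rwa [natDegree_map]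
  have hfilt := filtData bs (f₀.map (algebraMap k₀ k)) hF hbs0 hbs1
  have := aux_infinite bs
  have := aux_finite_class bs
  have := aux_finite_class bs'
  refine final_abstract hfilt
    ((AdjoinRoot.of (X ^ 2 - C (f₀.map (algebraMap k₀ k')) : (k'[X])[X])).comp (C : k' →+* k'[X]))
    ?_ (r := p ^ (m - n)) hpodd.pow ?_ hp I hI hIp
  · rw [eq_top_iff]
    intro s _
    obtain ⟨g, rfl⟩ := AdjoinRoot.mk_surjective s
    have hof : ∀ a : k'[X], AdjoinRoot.of (X ^ 2 - C (f₀.map (algebraMap k₀ k')) : (k'[X])[X]) a ∈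
        Algebra.adjoin (AdjoinRoot (X ^ 2 - C (f₀.map (algebraMap k₀ k)) : (k[X])[X]))
          (Set.range ((AdjoinRoot.of (X ^ 2 - C (f₀.map (algebraMap k₀ k')) : (k'[X])[X])).comp
            (C : k' →+* k'[X]))) := by
      have hX : AdjoinRoot.of (X ^ 2 - C (f₀.map (algebraMap k₀ k')) : (k'[X])[X]) X ∈
          Algebra.adjoin (AdjoinRoot (X ^ 2 - C (f₀.map (algebraMap k₀ k)) : (k[X])[X]))
          (Set.range ((AdjoinRoot.of (X ^ 2 - C (f₀.map (algebraMap k₀ k')) : (k'[X])[X])).comp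
            (C : k' →+* k'[X]))) := by
        have h1 := halg₁ X
        rw [map_X] at h1
        rw [← h1]
        exact Subalgebra.algebraMap_mem _ _
      intro a
      induction a using Polynomial.induction_on' with
      | add a b ha hb => rw [map_add]; exact add_mem ha hb
      | monomial i c =>
        rw [← C_mul_X_pow_eq_monomial, map_mul, map_pow]
        exact mul_mem (Algebra.subset_adjoin ⟨c, rfl⟩) (pow_mem hX i)
    induction g using Polynomial.induction_on' with
    | add a b ha hb => rw [map_add]; exact add_mem (ha trivial) (hb trivial)
    | monomial i c =>
      rw [← C_mul_X_pow_eq_monomial, map_mul, map_pow, AdjoinRoot.mk_C, AdjoinRoot.mk_X, ← halg₂]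
      exact mul_mem (hof c) (pow_mem (Subalgebra.algebraMap_mem _ _) i)
  · rw [Nat.card_eq_fintype_card, hk, hk', ← pow_mul, ← pow_add, Nat.add_sub_cancel' hnm]
end
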